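/- There is an absolute constant C > 0 such that for all real x ≥ 2, every nonzero integer a with |a| < x^{1/2}, and every real R with 1 ≤ R ≤ x^{1/2}, one has | Σ_{q ≤ x, gcd(q,a)=1} ρ_R*(x;q,a) − x·(φ(|a|)/|a|)·Σ_{r ≤ R, gcd(r,a)=1} ( μ(r)²/(r·φ(r)) )·( log(x/r²) + 2γ − 1 + Σ_{p | a} (log p)/(p−1) ) − x·(φ(|a|)/|a|)·Σ_{p | a} ( (log p)/(p−1) )·Σ_{t ≤ R/p, gcd(t,a)=1} μ(t)²/(t·φ(t)) | ≤ C·( |a|·log x + 2^{ω(a)}·R·x^{1/2} ), where q, r, t run over positive integers coprime to a, Σ_{p | a} is over primes p dividing a, γ is the Euler–Mascheroni constant, and ω(a) denotes the number of distinct prime factors of a. -/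

import Mathlib

open Finset Real

/-- Vaughan's function `F_R(n) = ∑_{r ≤ R} μ(r)² μ((r,n)) φ((r,n)) / φ(r)`. -/
noncomputable def FR (R : ℝ) (n : ℤ) : ℝ :=
  ∑ r ∈ Finset.Icc 1 ⌊R⌋₊,
    (ArithmeticFunction.moebius r : ℝ) ^ 2 *
      (ArithmeticFunction.moebius (Int.gcd (r : ℤ) n) : ℝ) *
      (Nat.totient (Int.gcd (r : ℤ) n) : ℝ) / (Nat.totient r : ℝ)

/-- `ρ_R^*(x;q,a) = ∑_{n ≤ x, n ≡ a (q), n > a} F_R(n)`. -/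
noncomputable def rhoStar (R x : ℝ) (q : ℕ) (a : ℤ) : ℝ :=
  ∑ n ∈ (Finset.Icc 1 ⌊x⌋₊).filter (fun n : ℕ => a < (n : ℤ) ∧ (q : ℤ) ∣ (n : ℤ) - a),
    FR R n

/-- `ψ^*(x;q,a) = ∑_{n ≤ x, n ≡ a (q), n > a} Λ(n)`. -/
noncomputable def psiStar (x : ℝ) (q : ℕ) (a : ℤ) : ℝ :=
  ∑ n ∈ (Finset.Icc 1 ⌊x⌋₊).filter (fun n : ℕ => a < (n : ℤ) ∧ (q : ℤ) ∣ (n : ℤ) - a),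
    ArithmeticFunction.vonMangoldt n

/-- `q` is divisible by no element of `P`. -/
abbrev Avoids (P : Finset ℕ) (q : ℕ) : Prop := ∀ p ∈ P, ¬ p ∣ q

/-- The density `∏_{p ∈ P} (1 - 1/p)` of the integers avoiding the primes in `P`. -/
noncomputable def density (P : Finset ℕ) : ℝ := ∏ p ∈ P, (1 - (p : ℝ)⁻¹)

/-- The sum `∑_{p ∈ P} log p / (p - 1)`. -/
noncomputable def logSum (P : Finset ℕ) : ℝ := ∑ p ∈ P, Real.log p / ((p : ℝ) - 1)

theorem sum_multiples (f : ℕ → ℝ) (z : ℝ) {p : ℕ} (hp : 0 < p) :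
    ∑ k ∈ Finset.Icc 1 ⌊z⌋₊, (if p ∣ k then f k else 0) =
      ∑ k ∈ Finset.Icc 1 ⌊z / p⌋₊, f (p * k) := by
  rw [← Finset.sum_filter]
  symm
  refine Finset.sum_bij (fun k _ => p * k) ?_ ?_ ?_ ?_
  · intro k hk
    rw [Nat.floor_div_natCast] at hk
    simp only [Finset.mem_Icc, Finset.mem_filter] at hk ⊢
    refine ⟨⟨Nat.mul_pos hp hk.1, ?_⟩, dvd_mul_right _ _⟩
    rw [mul_comm]
    exact (Nat.le_div_iff_mul_le hp).1 hk.2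
  · intro k _ l _ h
    exact Nat.eq_of_mul_eq_mul_left hp h
  · intro k hk
    simp only [Finset.mem_Icc, Finset.mem_filter] at hk
    obtain ⟨⟨h1, h2⟩, l, rfl⟩ := hk
    refine ⟨l, ?_, rfl⟩
    rw [Nat.floor_div_natCast]
    simp only [Finset.mem_Icc]
    refine ⟨Nat.pos_of_mul_pos_left h1, ?_⟩
    rw [Nat.le_div_iff_mul_le hp, mul_comm]
    exact h2
  · intro k _
    rfl

theorem avoids_mul_left {P : Finset ℕ} {p : ℕ} (hP : ∀ l ∈ P, l.Prime) (hp : p.Prime)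
    (hpP : p ∉ P) (k : ℕ) : Avoids P (p * k) ↔ Avoids P k := by
  refine forall₂_congr fun l hl => not_congr ?_
  rw [(hP l hl).dvd_mul]
  refine ⟨fun h => h.resolve_left fun h' => ?_, Or.inr⟩
  exact hpP (((Nat.prime_dvd_prime_iff_eq (hP l hl) hp).1 h') ▸ hl)

theorem sum_avoids_insert {P : Finset ℕ} {p : ℕ} (hP : ∀ l ∈ P, l.Prime) (hp : p.Prime)
    (hpP : p ∉ P) (f : ℕ → ℝ) (z : ℝ) :
    ∑ k ∈ Finset.Icc 1 ⌊z⌋₊, (if Avoids (insert p P) k then f k else 0) =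
      ∑ k ∈ Finset.Icc 1 ⌊z⌋₊, (if Avoids P k then f k else 0) -
        ∑ k ∈ Finset.Icc 1 ⌊z / p⌋₊, (if Avoids P k then f (p * k) else 0) := by
  have h := sum_multiples (fun k => if Avoids P k then f k else 0) z hp.pos
  simp only [avoids_mul_left hP hp hpP] at h
  rw [← h, ← Finset.sum_sub_distrib]
  refine Finset.sum_congr rfl fun k _ => ?_
  have : Avoids (insert p P) k ↔ ¬ p ∣ k ∧ Avoids P k := by simp [Avoids]
  by_cases h1 : p ∣ k <;> by_cases h2 : Avoids P k <;> simp only [this, h1, h2] <;> simp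

theorem abs_harmonic_sub_le {z : ℝ} (hz : 0 < z) :
    |∑ k ∈ Finset.Icc 1 ⌊z⌋₊, (k : ℝ)⁻¹ - (Real.log z + Real.eulerMascheroniConstant)| ≤
      2 / z := by
  have hg1 := Real.one_half_lt_eulerMascheroniConstant
  have hg2 := Real.eulerMascheroniConstant_lt_two_thirds
  rcases lt_or_ge z 1 with h1 | h1
  · have h0 : ⌊z⌋₊ = 0 := Nat.floor_eq_zero.2 h1
    have hl : Real.log z < 0 := Real.log_neg hz h1
    have hl2 := Real.one_sub_inv_le_log_of_pos hz
    have hz1 : 1 ≤ z⁻¹ := (one_le_inv₀ hz).2 h1.le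
    rw [h0, div_eq_mul_inv, abs_le]
    constructor <;> simp <;> linarith
  · set n := ⌊z⌋₊ with hn
    have hn1 : 1 ≤ n := Nat.le_floor (by simpa using h1)
    have hnz : (n : ℝ) ≤ z := Nat.floor_le hz.le
    have hzn : z < n + 1 := Nat.lt_floor_add_one z
    have hn0 : (0 : ℝ) < n := by exact_mod_cast hn1
    have hH : ∑ k ∈ Finset.Icc 1 n, (k : ℝ)⁻¹ = (harmonic n : ℝ) := by
      rw [harmonic_eq_sum_Icc]; push_cast; rfl
    have e1 := Real.eulerMascheroniSeq_lt_eulerMascheroniConstant n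
    have e2 := Real.eulerMascheroniConstant_lt_eulerMascheroniSeq' n
    rw [Real.eulerMascheroniSeq] at e1
    rw [Real.eulerMascheroniSeq', if_neg (by omega)] at e2
    have l1 : Real.log (n + 1) - Real.log z ≤ 1 / z := by
      rw [← Real.log_div (by positivity) hz.ne']
      refine (Real.log_le_sub_one_of_pos (by positivity)).trans ?_
      rw [div_sub_one hz.ne']
      gcongr; linarith
    have l2 : Real.log z - Real.log n ≤ 2 / z := by
      rw [← Real.log_div hz.ne' (by positivity)]
      refine (Real.log_le_sub_one_of_pos (by positivity)).trans ?_
      rw [div_sub_one hn0.ne', div_le_div_iff₀ hn0 hz]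
      have : (1 : ℝ) ≤ n := by exact_mod_cast hn1
      nlinarith
    have : 1 / z ≤ 2 / z := by gcongr; norm_num
    rw [hH, abs_le]
    constructor <;> linarith

theorem density_insert {P : Finset ℕ} {p : ℕ} (hpP : p ∉ P) :
    density (insert p P) = (1 - (p : ℝ)⁻¹) * density P := Finset.prod_insert hpP

theorem logSum_insert {P : Finset ℕ} {p : ℕ} (hpP : p ∉ P) :
    logSum (insert p P) = Real.log p / ((p : ℝ) - 1) + logSum P := Finset.sum_insert hpP

theorem abs_avoids_harmonic_sub_le {P : Finset ℕ} (hP : ∀ p ∈ P, p.Prime) {z : ℝ} (hz : 0 < z) :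
    |∑ k ∈ Finset.Icc 1 ⌊z⌋₊, (if Avoids P k then (k : ℝ)⁻¹ else 0) -
        density P * (Real.log z + Real.eulerMascheroniConstant + logSum P)| ≤
      2 ^ P.card * (2 / z) := by
  induction P using Finset.induction_on generalizing z with
  | empty => simpa [Avoids, density, logSum] using abs_harmonic_sub_le hz
  | insert p P hpP ih =>
    have hp : p.Prime := hP p (Finset.mem_insert_self _ _)
    have hP' : ∀ l ∈ P, l.Prime := fun l hl => hP l (Finset.mem_insert_of_mem hl)
    have hp1 : (1 : ℝ) < p := by exact_mod_cast hp.one_lt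
    have hp0 : (0 : ℝ) < p := by linarith
    have a1 := ih hP' hz
    have a2 := ih hP' (div_pos hz hp0)
    have e : ∑ k ∈ Finset.Icc 1 ⌊z / p⌋₊, (if Avoids P k then ((p * k : ℕ) : ℝ)⁻¹ else 0) =
        (p : ℝ)⁻¹ * ∑ k ∈ Finset.Icc 1 ⌊z / p⌋₊, (if Avoids P k then (k : ℝ)⁻¹ else 0) := by
      rw [Finset.mul_sum]
      refine Finset.sum_congr rfl fun k _ => ?_
      split_ifs <;> simp [mul_comm]
    rw [sum_avoids_insert hP' hp hpP, e, density_insert hpP, logSum_insert hpP,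
      Finset.card_insert_of_notMem hpP]
    rw [Real.log_div hz.ne' hp0.ne'] at a2
    set A := ∑ k ∈ Finset.Icc 1 ⌊z⌋₊, (if Avoids P k then (k : ℝ)⁻¹ else 0)
    set B := ∑ k ∈ Finset.Icc 1 ⌊z / p⌋₊, (if Avoids P k then (k : ℝ)⁻¹ else 0)
    have hp1' : (p : ℝ) - 1 ≠ 0 := by linarith
    have key : A - (p : ℝ)⁻¹ * B - (1 - (p : ℝ)⁻¹) * density P * (Real.log z +
          Real.eulerMascheroniConstant + (Real.log p / ((p : ℝ) - 1) + logSum P)) =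
        (A - density P * (Real.log z + Real.eulerMascheroniConstant + logSum P)) -
        (p : ℝ)⁻¹ * (B - density P * (Real.log z - Real.log p + Real.eulerMascheroniConstant
          + logSum P)) := by
      field_simp; ring
    rw [key]
    refine (abs_sub _ _).trans ?_
    rw [abs_mul, abs_of_pos (inv_pos.2 hp0)]
    have : (p : ℝ)⁻¹ * (2 ^ P.card * (2 / (z / p))) = 2 ^ P.card * (2 / z) := by
      field_simp
    have a3 := mul_le_mul_of_nonneg_left a2 (inv_pos.2 hp0).le
    rw [pow_succ]
    linarith

theorem abs_card_congr_sub_le {d k : ℕ} (hd : 0 < d) (hk : Nat.Coprime k d) (c : ℤ) {z : ℝ}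
    (hz : 0 ≤ z) :
    |∑ q ∈ Finset.Icc 1 ⌊z⌋₊, (if (d : ℤ) ∣ c + k * q then (1 : ℝ) else 0) - z / d| ≤ 2 := by
  have hd' : (0 : ℤ) < d := by exact_mod_cast hd
  obtain ⟨v, hv⟩ : ∃ v : ℤ, ∀ q : ℤ, (d : ℤ) ∣ c + k * q ↔ q ≡ v [ZMOD d] := by
    have hc : IsCoprime (k : ℤ) d := Nat.isCoprime_iff_coprime.2 hk
    obtain ⟨u, w, huw⟩ := hc
    refine ⟨-(u * c), fun q => ?_⟩
    rw [Int.modEq_iff_dvd]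
    have h1 : -(u * c) - q = -(u * (c + k * q)) - w * d * q := by linear_combination q * huw
    constructor
    · intro h
      rw [h1]
      exact dvd_sub (dvd_neg.2 (h.mul_left _)) ⟨w * q, by ring⟩
    · intro h
      have h2 : c + k * q = -(k * (-(u * c) - q)) + d * (w * c) := by linear_combination -c * huw
      rw [h2]
      exact dvd_add (dvd_neg.2 (h.mul_left _)) (dvd_mul_right _ _)
  set N := ⌊z⌋₊
  have hcard := Int.Ioc_filter_modEq_card 0 (N : ℤ) hd' v
  have hsum : ∑ q ∈ Finset.Icc 1 N, (if (d : ℤ) ∣ c + k * q then (1 : ℝ) else 0) =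
      (((Finset.Ioc 0 (N : ℤ)).filter (fun q => q ≡ v [ZMOD d])).card : ℝ) := by
    rw [← Finset.sum_filter, Finset.sum_const, nsmul_eq_mul, mul_one]
    congr 1
    refine Finset.card_bij (fun q _ => (q : ℤ)) ?_ ?_ ?_
    · intro q hq
      simp only [Finset.mem_filter, Finset.mem_Icc, Finset.mem_Ioc] at hq ⊢
      exact ⟨by omega, (hv q).1 hq.2⟩
    · intro a _ b _ h
      exact_mod_cast h
    · intro q hq
      simp only [Finset.mem_filter, Finset.mem_Ioc] at hq
      refine ⟨q.toNat, ?_, by omega⟩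
      have : ((q.toNat : ℕ) : ℤ) = q := by omega
      simp only [Finset.mem_filter, Finset.mem_Icc, this]
      exact ⟨by omega, (hv q).2 hq.2⟩
  have hN1 : (N : ℝ) ≤ z := Nat.floor_le hz
  have hN2 : z < N + 1 := Nat.lt_floor_add_one z
  have hdr : (1 : ℝ) ≤ d := by exact_mod_cast hd
  rw [hsum]
  have hfl := Int.floor_le (((N : ℤ) - v : ℚ) / (d : ℤ))
  have hfl2 := Int.lt_floor_add_one (((N : ℤ) - v : ℚ) / (d : ℤ))
  have hfl3 := Int.floor_le ((((0 : ℤ) : ℚ) - v : ℚ) / (d : ℤ))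
  have hfl4 := Int.lt_floor_add_one ((((0 : ℤ) : ℚ) - v : ℚ) / (d : ℤ))
  have hmono : ⌊(((0 : ℤ) : ℚ) - v : ℚ) / (d : ℤ)⌋ ≤ ⌊(((N : ℤ) - v : ℚ) / (d : ℤ))⌋ := by
    apply Int.floor_le_floor
    have : (0 : ℚ) < (d : ℤ) := by exact_mod_cast hd
    gcongr
    simp
  rw [max_eq_left (by linarith)] at hcard
  set X := ((Finset.Ioc 0 (N : ℤ)).filter (fun q => q ≡ v [ZMOD d])).card
  have hX : ((X : ℤ) : ℚ) = (⌊(((N : ℤ) - v : ℚ) / (d : ℤ))⌋ : ℚ) -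
      ⌊(((0 : ℤ) : ℚ) - v : ℚ) / (d : ℤ)⌋ := by
    rw [hcard]; push_cast; rfl
  have hsub : ((N : ℤ) - v : ℚ) / (d : ℤ) = (N : ℚ) / d + (((0 : ℤ) : ℚ) - v : ℚ) / (d : ℤ) := by
    push_cast; ring
  have b1 : ((X : ℕ) : ℚ) ≤ (N : ℚ) / d + 1 := by
    have : ((X : ℤ) : ℚ) = (X : ℚ) := by norm_cast
    linarith
  have b2 : (N : ℚ) / d - 1 ≤ ((X : ℕ) : ℚ) := by
    have : ((X : ℤ) : ℚ) = (X : ℚ) := by norm_cast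
    linarith
  have b1' : (X : ℝ) ≤ (N : ℝ) / d + 1 := by
    have := (Rat.cast_le (K := ℝ)).2 b1
    push_cast at this
    exact this
  have b2' : (N : ℝ) / d - 1 ≤ (X : ℝ) := by
    have := (Rat.cast_le (K := ℝ)).2 b2
    push_cast at this
    exact this
  have c1 : (N : ℝ) / d ≤ z / d := by gcongr
  have c2 : z / d ≤ (N : ℝ) / d + 1 := by
    rw [div_add_one (by linarith)]
    gcongr
    linarith
  rw [abs_le]
  constructor <;> linarith

theorem abs_card_avoids_congr_sub_le {P : Finset ℕ} (hP : ∀ p ∈ P, p.Prime) {d k : ℕ} (hd : 0 < d)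
    (hPd : Avoids P d) (hk : Nat.Coprime k d) (c : ℤ) {z : ℝ} (hz : 0 ≤ z) :
    |∑ q ∈ Finset.Icc 1 ⌊z⌋₊,
        (if Avoids P q then (if (d : ℤ) ∣ c + k * q then (1 : ℝ) else 0) else 0) -
        density P * (z / d)| ≤ 2 ^ P.card * 2 := by
  induction P using Finset.induction_on generalizing z k with
  | empty => simpa [Avoids, density] using abs_card_congr_sub_le hd hk c hz
  | insert p P hpP ih =>
    have hp : p.Prime := hP p (Finset.mem_insert_self _ _)
    have hP' : ∀ l ∈ P, l.Prime := fun l hl => hP l (Finset.mem_insert_of_mem hl)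
    have hPd' : Avoids P d := fun l hl => hPd l (Finset.mem_insert_of_mem hl)
    have hp0 : (0 : ℝ) < p := by exact_mod_cast hp.pos
    have hpd : Nat.Coprime p d := (hp.coprime_iff_not_dvd).2 (hPd p (Finset.mem_insert_self _ _))
    have a1 := ih hP' hPd' hk hz
    have a2 := ih hP' hPd' (hk.mul_left hpd) (div_nonneg hz hp0.le)
    have e : ∀ q : ℕ, c + (k : ℤ) * ((p * q : ℕ) : ℤ) = c + ((k * p : ℕ) : ℤ) * q := by
      intro q; push_cast; ring
    rw [sum_avoids_insert hP' hp hpP, density_insert hpP, Finset.card_insert_of_notMem hpP]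
    simp only [e]
    rw [pow_succ]
    have key : ∀ A B : ℝ, A - B - (1 - (p : ℝ)⁻¹) * density P * (z / d) =
        (A - density P * (z / d)) - (B - density P * (z / p / d)) := by
      intro A B; ring
    rw [key]
    refine (abs_sub _ _).trans ?_
    linarith

theorem sum_divisors_moebius (n : ℕ) :
    ∑ d ∈ n.divisors, (ArithmeticFunction.moebius d : ℝ) = if n = 1 then 1 else 0 := by
  have h := congrArg (fun f => f n) ArithmeticFunction.coe_zeta_mul_moebius
  simp only [ArithmeticFunction.coe_zeta_mul_apply, ArithmeticFunction.one_apply] at h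
  exact_mod_cast h

theorem sum_divisors_coprime_moebius {r q : ℕ} (hr : Squarefree r) (hq : q ≠ 0) :
    ∑ d ∈ r.divisors, (if Nat.Coprime d q then (ArithmeticFunction.moebius d : ℝ) else 0) =
      if r ∣ q then 1 else 0 := by
  have hr0 : r ≠ 0 := hr.ne_zero
  have hg : 0 < r.gcd q := Nat.gcd_pos_of_pos_right _ (Nat.pos_of_ne_zero hq)
  have hdiv : r / r.gcd q ≠ 0 :=
    (Nat.div_pos (Nat.gcd_le_left _ (Nat.pos_of_ne_zero hr0)) hg).ne'
  have hcop := Nat.coprime_div_gcd_of_squarefree hr hq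
  have hset : r.divisors.filter (fun d => Nat.Coprime d q) = (r / r.gcd q).divisors := by
    ext d
    simp only [Finset.mem_filter, Nat.mem_divisors]
    constructor
    · rintro ⟨⟨h1, -⟩, h2⟩
      refine ⟨?_, hdiv⟩
      have h3 : d.Coprime (r.gcd q) := h2.coprime_dvd_right (Nat.gcd_dvd_right _ _)
      refine h3.dvd_of_dvd_mul_right ?_
      rwa [Nat.div_mul_cancel (Nat.gcd_dvd_left _ _)]
    · rintro ⟨h1, -⟩
      exact ⟨⟨h1.trans (Nat.div_dvd_of_dvd (Nat.gcd_dvd_left _ _)), hr0⟩,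
        hcop.coprime_dvd_left h1⟩
  rw [← Finset.sum_filter, hset, sum_divisors_moebius]
  congr 1
  rw [eq_iff_iff, Nat.div_eq_iff_eq_mul_left hg (Nat.gcd_dvd_left _ _), one_mul, eq_comm,
    Nat.gcd_eq_left_iff_dvd]

/-- `∑_{d ∣ (r, n)} d μ(d)`, which is `μ((r, n)) φ((r, n))` for squarefree `r`. -/
noncomputable def divisorWeight (r : ℕ) (n : ℤ) : ℝ :=
  ∑ d ∈ r.divisors, (if (d : ℤ) ∣ n then (d : ℝ) * ArithmeticFunction.moebius d else 0)

theorem sum_divisors_mul_moebius {h : ℕ} (hh : Squarefree h) :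
    ∑ d ∈ h.divisors, (d : ℝ) * ArithmeticFunction.moebius d =
      ArithmeticFunction.moebius h * Nat.totient h := by
  have h1 := ArithmeticFunction.IsMultiplicative.prodPrimeFactors_one_sub_of_squarefree
    (R := ℝ) (ArithmeticFunction.id : ArithmeticFunction ℕ)
    (ArithmeticFunction.isMultiplicative_id.natCast) hh
  have h2 : ∑ d ∈ h.divisors, (d : ℝ) * ArithmeticFunction.moebius d =
      ∏ p ∈ h.primeFactors, (1 - (p : ℝ)) := by
    simp only [ArithmeticFunction.natCoe_apply, ArithmeticFunction.id_apply] at h1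
    rw [h1]
    exact Finset.sum_congr rfl fun d _ => mul_comm _ _
  have h3 := Nat.totient_eq_mul_prod_factors h
  have h4 : (Nat.totient h : ℝ) = h * ∏ p ∈ h.primeFactors, (1 - (p : ℝ)⁻¹) := by
    have := congrArg (fun t : ℚ => (t : ℝ)) h3
    push_cast at this
    exact this
  have h5 : (h : ℝ) = ∏ p ∈ h.primeFactors, (p : ℝ) := by
    conv_lhs => rw [← Nat.prod_primeFactors_of_squarefree hh]
    push_cast; rfl
  have h6 : (ArithmeticFunction.moebius h : ℝ) = ∏ p ∈ h.primeFactors, (-1 : ℝ) := by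
    conv_lhs => rw [← Nat.prod_primeFactors_of_squarefree hh]
    rw [ArithmeticFunction.isMultiplicative_moebius.map_prod_of_prime _
      (fun p hp => Nat.prime_of_mem_primeFactors hp)]
    push_cast
    refine Finset.prod_congr rfl fun p hp => ?_
    rw [ArithmeticFunction.moebius_apply_prime (Nat.prime_of_mem_primeFactors hp)]
    simp
  rw [h2, h4, h6, h5, ← Finset.prod_mul_distrib, ← Finset.prod_mul_distrib]
  refine Finset.prod_congr rfl fun p hp => ?_
  have : (p : ℝ) ≠ 0 := by exact_mod_cast (Nat.prime_of_mem_primeFactors hp).ne_zero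
  field_simp
  ring

theorem divisorWeight_eq {r : ℕ} (hr : Squarefree r) (n : ℤ) :
    divisorWeight r n = (ArithmeticFunction.moebius (Int.gcd (r : ℤ) n) : ℝ) *
      (Nat.totient (Int.gcd (r : ℤ) n) : ℝ) := by
  have hg : Int.gcd (r : ℤ) n ∣ r := by
    have := Int.gcd_dvd_left (r : ℤ) n
    exact_mod_cast this
  rw [← sum_divisors_mul_moebius (hr.squarefree_of_dvd hg), divisorWeight, ← Finset.sum_filter]
  refine Finset.sum_congr ?_ fun _ _ => rfl
  ext d
  simp only [Finset.mem_filter, Nat.mem_divisors]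
  constructor
  · rintro ⟨⟨h1, -⟩, h2⟩
    refine ⟨?_, (hr.squarefree_of_dvd hg).ne_zero⟩
    exact Int.dvd_gcd (by exact_mod_cast h1) h2
  · rintro ⟨h1, -⟩
    refine ⟨⟨h1.trans hg, hr.ne_zero⟩, ?_⟩
    have h3 : (d : ℤ) ∣ (Int.gcd (r : ℤ) n : ℤ) := by exact_mod_cast h1
    exact h3.trans (Int.gcd_dvd_right _ _)

/-- The sum of the divisors of `r`, as a real number. -/
noncomputable def sigmaReal (r : ℕ) : ℝ := ∑ d ∈ r.divisors, (d : ℝ)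

theorem sigmaReal_nonneg (r : ℕ) : 0 ≤ sigmaReal r := Finset.sum_nonneg fun _ _ => by positivity

theorem abs_moebius_real_le_one (d : ℕ) : |(ArithmeticFunction.moebius d : ℝ)| ≤ 1 := by
  exact_mod_cast ArithmeticFunction.abs_moebius_le_one (n := d)

/-- Weighted errors over the divisors of `r` add up to at most a multiple of `σ(r)`. -/
theorem abs_sum_divisors_sub_le (r : ℕ) (f g : ℕ → ℝ) {E : ℝ}
    (h : ∀ d ∈ r.divisors, |f d - g d| ≤ E) :
    |∑ d ∈ r.divisors, (d : ℝ) * ArithmeticFunction.moebius d * f d -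
      ∑ d ∈ r.divisors, (d : ℝ) * ArithmeticFunction.moebius d * g d| ≤ sigmaReal r * E := by
  rw [← Finset.sum_sub_distrib, sigmaReal, Finset.sum_mul]
  refine (Finset.abs_sum_le_sum_abs _ _).trans (Finset.sum_le_sum fun d hd => ?_)
  rw [← mul_sub, abs_mul, abs_mul, abs_of_nonneg (Nat.cast_nonneg d : (0 : ℝ) ≤ d)]
  have h1 := abs_moebius_real_le_one d
  have h2 : (d : ℝ) * |(ArithmeticFunction.moebius d : ℝ)| ≤ d :=
    mul_le_of_le_one_right (Nat.cast_nonneg d) h1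
  exact mul_le_mul h2 (h d hd) (abs_nonneg _) (Nat.cast_nonneg d)

theorem sum_divisorWeight {ι : Type*} (s : Finset ι) (w : ι → ℝ) (r : ℕ) (n : ι → ℤ) :
    ∑ i ∈ s, w i * divisorWeight r (n i) =
      ∑ d ∈ r.divisors, (d : ℝ) * ArithmeticFunction.moebius d *
        ∑ i ∈ s, w i * (if (d : ℤ) ∣ n i then (1 : ℝ) else 0) := by
  simp only [divisorWeight, Finset.mul_sum]
  rw [Finset.sum_comm]
  refine Finset.sum_congr rfl fun d _ => Finset.sum_congr rfl fun i _ => ?_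
  split_ifs <;> ring

theorem abs_sum_divisorWeight_sub_le {r q : ℕ} {a : ℤ} (hr : Squarefree r) (hq : q ≠ 0)
    (hqa : Nat.Coprime q a.natAbs) {z : ℝ} (hz : 0 ≤ z) :
    |∑ m ∈ Finset.Icc 1 ⌊z⌋₊, divisorWeight r (a + q * m) - (if r ∣ q then z else 0)| ≤
      2 * sigmaReal r := by
  have h1 := sum_divisorWeight (Finset.Icc 1 ⌊z⌋₊) (fun _ => 1) r (fun m : ℕ => a + q * m)
  simp only [one_mul] at h1
  have h2 : (if r ∣ q then z else 0) = ∑ d ∈ r.divisors, (d : ℝ) * ArithmeticFunction.moebius d *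
      (if Nat.Coprime d q then z / d else 0) := by
    have h3 := sum_divisors_coprime_moebius hr hq
    have : (if r ∣ q then z else 0) = z * (if r ∣ q then 1 else 0) := by simp
    rw [this, ← h3, Finset.mul_sum]
    refine Finset.sum_congr rfl fun d hd => ?_
    have : (d : ℝ) ≠ 0 := by exact_mod_cast (Nat.pos_of_mem_divisors hd).ne'
    split_ifs
    · field_simp
    · simp
  rw [h1, h2, mul_comm]
  refine abs_sum_divisors_sub_le r _ _ fun d hd => ?_
  split_ifs with hdq
  · exact abs_card_congr_sub_le (Nat.pos_of_mem_divisors hd) hdq.symm a hz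
  · rw [Finset.sum_eq_zero]
    · simp
    · intro m _
      rw [if_neg]
      intro hdvd
      apply hdq
      have e1 : ((d.gcd q : ℕ) : ℤ) ∣ a := by
        have e2 : ((d.gcd q : ℕ) : ℤ) ∣ a + q * m :=
          (Int.natCast_dvd_natCast.2 (Nat.gcd_dvd_left d q)).trans hdvd
        exact (dvd_add_left ((Int.natCast_dvd_natCast.2 (Nat.gcd_dvd_right d q)).mul_right _)).1 e2
      have e3 : d.gcd q ∣ a.natAbs := Int.natCast_dvd.1 e1
      have e4 := Nat.dvd_gcd (Nat.gcd_dvd_right d q) e3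
      rw [hqa.gcd_eq_one] at e4
      exact Nat.dvd_one.1 e4

theorem sum_divisors_mul_coprime {m n : ℕ} (hmn : m.Coprime n) (f : ℕ → ℝ) :
    ∑ d ∈ (m * n).divisors, f d = ∑ d ∈ m.divisors, ∑ e ∈ n.divisors, f (d * e) := by
  rw [Nat.divisors_mul, Finset.mul_def, Finset.sum_image, Finset.sum_product]
  exact fun p hp q hq h => hmn.mul_injOn_divisors hp hq h

theorem coprime_natAbs_iff_avoids {a : ℤ} (ha : a ≠ 0) (q : ℕ) :
    Nat.Coprime q a.natAbs ↔ Avoids a.natAbs.primeFactors q := by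
  have ha' : a.natAbs ≠ 0 := Int.natAbs_ne_zero.2 ha
  rw [Nat.coprime_comm, ← not_iff_not, Nat.Prime.not_coprime_iff_dvd]
  simp only [Avoids, Nat.mem_primeFactors]
  push Not
  exact ⟨fun ⟨p, h1, h2, h3⟩ => ⟨p, ⟨h1, h2, ha'⟩, h3⟩, fun ⟨p, ⟨h1, h2, _⟩, h3⟩ => ⟨p, h1, h2, h3⟩⟩

/-- The mean value over `q` coprime to `a` of `divisorWeight (r * s) (a + q * m)`, where `r` is
coprime to `a` and `s` divides `a`. -/
noncomputable def meanWeight (r s m : ℕ) : ℝ :=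
  if r ∣ m then ∑ d ∈ s.divisors, (if d ∣ m then (d : ℝ) * ArithmeticFunction.moebius d else 0)
  else 0

theorem meanWeight_eq_sum {r s m : ℕ} (hr : Squarefree r) (hm : m ≠ 0) (hrs : r.Coprime s) :
    meanWeight r s m = ∑ d ∈ (r * s).divisors, (d : ℝ) * ArithmeticFunction.moebius d *
      (if Nat.Coprime (d.gcd r) m ∧ d.gcd s ∣ m then ((d.gcd r : ℕ) : ℝ)⁻¹ else 0) := by
  rw [sum_divisors_mul_coprime hrs]
  have e1 : meanWeight r s m = (if r ∣ m then (1 : ℝ) else 0) *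
      ∑ d ∈ s.divisors, (if d ∣ m then (d : ℝ) * ArithmeticFunction.moebius d else 0) := by
    rw [meanWeight]; split_ifs <;> simp
  rw [e1, ← sum_divisors_coprime_moebius hr hm, Finset.sum_mul]
  refine Finset.sum_congr rfl fun d hd => ?_
  rw [Finset.mul_sum]
  refine Finset.sum_congr rfl fun e he => ?_
  have hdr := Nat.dvd_of_mem_divisors hd
  have hes := Nat.dvd_of_mem_divisors he
  have hde : d.Coprime e := (hrs.coprime_dvd_left hdr).coprime_dvd_right hes
  have g1 : (d * e).gcd r = d := by
    rw [Nat.Coprime.gcd_mul_right_cancel _ (hrs.symm.coprime_dvd_left hes)]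
    exact Nat.gcd_eq_left hdr
  have g2 : (d * e).gcd s = e := by
    rw [Nat.Coprime.gcd_mul_left_cancel _ (hrs.coprime_dvd_left hdr)]
    exact Nat.gcd_eq_left hes
  have hd0 : (d : ℝ) ≠ 0 := by exact_mod_cast (Nat.pos_of_mem_divisors hd).ne'
  rw [g1, g2, ArithmeticFunction.isMultiplicative_moebius.map_mul_of_coprime hde]
  push_cast
  by_cases c1 : d.Coprime m <;> by_cases c2 : e ∣ m <;> simp [c1, c2]
  field_simp

theorem abs_sum_avoids_divisorWeight_sub_le {r s m : ℕ} {a : ℤ} (ha : a ≠ 0)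
    (hr : Squarefree r) (hra : r.Coprime a.natAbs) (hsa : s ∣ a.natAbs) (hm : m ≠ 0) {z : ℝ}
    (hz : 0 ≤ z) :
    |∑ q ∈ Finset.Icc 1 ⌊z⌋₊, (if Avoids a.natAbs.primeFactors q then
        divisorWeight (r * s) (a + q * m) else 0) -
      density a.natAbs.primeFactors * z * meanWeight r s m| ≤
      2 ^ a.natAbs.primeFactors.card * 2 * sigmaReal (r * s) := by
  set P := a.natAbs.primeFactors with hPdef
  have hrs : r.Coprime s := hra.coprime_dvd_right hsa
  have hP : ∀ p ∈ P, p.Prime := fun p hp => Nat.prime_of_mem_primeFactors hp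
  have h1 := sum_divisorWeight (Finset.Icc 1 ⌊z⌋₊) (fun q => if Avoids P q then 1 else 0) (r * s)
    (fun q : ℕ => a + q * m)
  simp only [ite_mul, one_mul, zero_mul] at h1
  rw [h1, meanWeight_eq_sum hr hm hrs, Finset.mul_sum]
  have h2 : ∀ d ∈ (r * s).divisors, density P * z * ((d : ℝ) * ArithmeticFunction.moebius d *
      (if Nat.Coprime (d.gcd r) m ∧ d.gcd s ∣ m then ((d.gcd r : ℕ) : ℝ)⁻¹ else 0)) =
      (d : ℝ) * ArithmeticFunction.moebius d * (density P * z *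
        (if Nat.Coprime (d.gcd r) m ∧ d.gcd s ∣ m then ((d.gcd r : ℕ) : ℝ)⁻¹ else 0)) := by
    intro d _; ring
  rw [Finset.sum_congr rfl h2, mul_comm (2 ^ P.card * 2 : ℝ)]
  refine abs_sum_divisors_sub_le _ _ _ fun d hd => ?_
  have hdvd := Nat.dvd_of_mem_divisors hd
  have hd0 := Nat.pos_of_mem_divisors hd
  set d₁ := d.gcd r with hd₁
  set d₂ := d.gcd s with hd₂
  have hdd : d = d₁ * d₂ := by
    rw [hd₁, hd₂, ← Nat.Coprime.gcd_mul d hrs]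
    exact (Nat.gcd_eq_left hdvd).symm
  have hd₁a : d₁.Coprime a.natAbs := hra.coprime_dvd_left (Nat.gcd_dvd_right _ _)
  have hd₂a : d₂ ∣ a.natAbs := (Nat.gcd_dvd_right _ _).trans hsa
  have hd₂a' : (d₂ : ℤ) ∣ a := Int.natCast_dvd.2 hd₂a
  have hcop : d₁.Coprime d₂ := hd₁a.coprime_dvd_right hd₂a
  have hiff : ∀ q : ℕ, Avoids P q →
      ((d : ℤ) ∣ a + q * m ↔ d₂ ∣ m ∧ (d₁ : ℤ) ∣ a + m * q) := by
    intro q hq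
    have hqa : q.Coprime a.natAbs := (coprime_natAbs_iff_avoids ha q).2 hq
    have hqd : d₂.Coprime q := (hqa.coprime_dvd_right hd₂a).symm
    have e1 : (d₂ : ℤ) ∣ a + q * m ↔ d₂ ∣ m := by
      rw [dvd_add_right hd₂a', ← Nat.cast_mul, Int.natCast_dvd_natCast]
      exact ⟨fun h => hqd.dvd_of_dvd_mul_left h, fun h => h.mul_left _⟩
    rw [← e1, mul_comm (m : ℤ) q, hdd, Nat.cast_mul]
    constructor
    · intro h
      exact ⟨(dvd_mul_left _ _).trans h, (dvd_mul_right _ _).trans h⟩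
    · rintro ⟨h3, h4⟩
      exact (Nat.isCoprime_iff_coprime.2 hcop).mul_dvd h4 h3
  have hpos : (0 : ℝ) ≤ 2 ^ P.card * 2 := by positivity
  by_cases hc : d₁.Coprime m ∧ d₂ ∣ m
  · rw [if_pos hc]
    have := abs_card_avoids_congr_sub_le hP (Nat.gcd_pos_of_pos_left r hd0)
      ((coprime_natAbs_iff_avoids ha d₁).1 hd₁a) hc.1.symm a hz
    rw [mul_assoc, ← div_eq_mul_inv]
    convert this using 5 with q _ hq
    simp only [hiff q hq, hc.2, true_and]
    rfl
  · rw [if_neg hc, Finset.sum_eq_zero]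
    · simp
    · intro q _
      split_ifs with h3 h4
      · exfalso
        obtain ⟨h5, h6⟩ := (hiff q h3).1 h4
        apply hc
        refine ⟨?_, h5⟩
        by_contra h7
        obtain ⟨l, hl, hl1, hl2⟩ := Nat.Prime.not_coprime_iff_dvd.1 h7
        have e2 : (l : ℤ) ∣ a + m * q := (Int.natCast_dvd_natCast.2 hl1).trans h6
        have e3 : (l : ℤ) ∣ a :=
          (dvd_add_left ((Int.natCast_dvd_natCast.2 hl2).mul_right _)).1 e2
        have e4 := Nat.dvd_gcd hl1 (Int.natCast_dvd.1 e3)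
        rw [hd₁a.gcd_eq_one] at e4
        exact hl.one_lt.ne' (Nat.dvd_one.1 e4)
      · rfl
      · rfl

theorem abs_sum_meanWeight_sub_le {r s : ℕ} (hr : r ≠ 0) (hrs : r.Coprime s)
    {U : ℝ} (hU : 0 < U) :
    |∑ m ∈ Finset.Icc 1 ⌊U⌋₊, (U ^ 2 / m - U) * meanWeight r s m -
      U ^ 2 / r * ((if s = 1 then Real.log U - Real.log r + Real.eulerMascheroniConstant - 1
        else 0) + ArithmeticFunction.vonMangoldt s)| ≤ sigmaReal s * (3 * U) := by
  have hr0 : (0 : ℝ) < r := by exact_mod_cast Nat.pos_of_ne_zero hr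
  have e1 : ∑ m ∈ Finset.Icc 1 ⌊U⌋₊, (U ^ 2 / m - U) * meanWeight r s m =
      ∑ d ∈ s.divisors, (d : ℝ) * ArithmeticFunction.moebius d *
        ∑ m ∈ Finset.Icc 1 ⌊U⌋₊, (if r * d ∣ m then (U ^ 2 / m - U) else 0) := by
    simp only [Finset.mul_sum]
    rw [Finset.sum_comm]
    refine Finset.sum_congr rfl fun m _ => ?_
    rw [meanWeight]
    split_ifs with h
    · rw [Finset.mul_sum]
      refine Finset.sum_congr rfl fun d hd => ?_
      have : r * d ∣ m ↔ d ∣ m := by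
        refine ⟨fun h' => (dvd_mul_left _ _).trans h', fun h' => ?_⟩
        exact (hrs.coprime_dvd_right (Nat.dvd_of_mem_divisors hd)).mul_dvd_of_dvd_of_dvd h h'
      simp only [this]
      split_ifs <;> ring
    · rw [mul_zero, Finset.sum_eq_zero]
      intro d _
      rw [if_neg fun h' => h ((dvd_mul_right _ _).trans h'), mul_zero]
  have e2 : U ^ 2 / r * ((if s = 1 then Real.log U - Real.log r +
        Real.eulerMascheroniConstant - 1 else 0) + ArithmeticFunction.vonMangoldt s) =
      ∑ d ∈ s.divisors, (d : ℝ) * ArithmeticFunction.moebius d *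
        (U ^ 2 / (r * d : ℕ) * (Real.log U - Real.log r - Real.log d +
          Real.eulerMascheroniConstant - 1)) := by
    have v1 := sum_divisors_moebius s
    have v2 := ArithmeticFunction.sum_moebius_mul_log_eq (n := s)
    simp only [ArithmeticFunction.log_apply] at v2
    have v3 : ArithmeticFunction.vonMangoldt s =
        -∑ d ∈ s.divisors, (ArithmeticFunction.moebius d : ℝ) * Real.log d := by
      rw [v2]; ring
    have v4 : (if s = 1 then Real.log U - Real.log r + Real.eulerMascheroniConstant - 1 else 0) =
        (if s = 1 then 1 else 0) *
          (Real.log U - Real.log r + Real.eulerMascheroniConstant - 1) := by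
      split_ifs <;> ring
    rw [v3, v4, ← v1, Finset.sum_mul, ← Finset.sum_neg_distrib, ← Finset.sum_add_distrib,
      Finset.mul_sum]
    refine Finset.sum_congr rfl fun d hd => ?_
    have hd0 : (d : ℝ) ≠ 0 := by exact_mod_cast (Nat.pos_of_mem_divisors hd).ne'
    push_cast
    field_simp
    ring
  rw [e1, e2]
  refine abs_sum_divisors_sub_le _ _ _ fun d hd => ?_
  have hd0 : (0 : ℝ) < d := by exact_mod_cast (Nat.pos_of_mem_divisors hd)
  have hrd : 0 < r * d := Nat.mul_pos (Nat.pos_of_ne_zero hr) (Nat.pos_of_mem_divisors hd)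
  rw [sum_multiples (fun m => U ^ 2 / m - U) U hrd]
  set D : ℝ := ((r * d : ℕ) : ℝ) with hD
  have hD0 : 0 < D := by rw [hD]; exact_mod_cast hrd
  have hlog : Real.log (U / D) = Real.log U - Real.log r - Real.log d := by
    rw [Real.log_div hU.ne' hD0.ne', hD, Nat.cast_mul, Real.log_mul hr0.ne' hd0.ne']; ring
  have hH := abs_harmonic_sub_le (div_pos hU hD0)
  have e3 : ∑ k ∈ Finset.Icc 1 ⌊U / D⌋₊, (U ^ 2 / ((r * d * k : ℕ) : ℝ) - U) =
      U ^ 2 / D * ∑ k ∈ Finset.Icc 1 ⌊U / D⌋₊, (k : ℝ)⁻¹ - ⌊U / D⌋₊ * U := by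
    rw [Finset.sum_sub_distrib, Finset.mul_sum]
    congr 1
    · refine Finset.sum_congr rfl fun k _ => ?_
      rw [Nat.cast_mul, ← hD, div_mul_eq_div_div, div_eq_mul_inv (U ^ 2 / D)]
    · simp
  rw [e3]
  set H := ∑ k ∈ Finset.Icc 1 ⌊U / D⌋₊, (k : ℝ)⁻¹
  rw [hlog] at hH
  have hf1 : (⌊U / D⌋₊ : ℝ) ≤ U / D := Nat.floor_le (div_pos hU hD0).le
  have hf2 : U / D < ⌊U / D⌋₊ + 1 := Nat.lt_floor_add_one _
  set L := Real.log U - Real.log r - Real.log d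
  have e4 : U ^ 2 / D * H - ⌊U / D⌋₊ * U - U ^ 2 / D * (L + Real.eulerMascheroniConstant - 1) =
      U ^ 2 / D * (H - (L + Real.eulerMascheroniConstant)) + (U / D - ⌊U / D⌋₊) * U := by
    field_simp; ring
  rw [e4]
  refine (abs_add_le _ _).trans ?_
  have b1 : |U ^ 2 / D * (H - (L + Real.eulerMascheroniConstant))| ≤ 2 * U := by
    rw [abs_mul, abs_of_pos (by positivity)]
    calc _ ≤ U ^ 2 / D * (2 / (U / D)) := by gcongr
      _ = 2 * U := by field_simp
  have b2 : |(U / D - ⌊U / D⌋₊) * U| ≤ U := by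
    rw [abs_mul, abs_of_pos hU, abs_of_nonneg (by linarith)]
    nlinarith
  linarith

theorem Icc_one_eq_Ioc (n : ℕ) : Finset.Icc 1 n = Finset.Ioc 0 n := by
  ext; simp only [Finset.mem_Icc, Finset.mem_Ioc]; omega

theorem sum_Ioc_eq_sub (f : ℕ → ℝ) {m n : ℕ} (h : m ≤ n) :
    ∑ k ∈ Finset.Ioc m n, f k = ∑ k ∈ Finset.Icc 1 n, f k - ∑ k ∈ Finset.Icc 1 m, f k := by
  rw [Icc_one_eq_Ioc, Icc_one_eq_Ioc, ← Finset.sum_Ioc_consecutive f (Nat.zero_le m) h]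
  ring

theorem sum_progression_eq (f : ℤ → ℝ) {q : ℕ} (hq : 0 < q) (a : ℤ) {x : ℝ} (hx : 0 ≤ x) :
    ∑ n ∈ (Finset.Icc 1 ⌊x⌋₊).filter (fun n : ℕ => a < (n : ℤ) ∧ (q : ℤ) ∣ (n : ℤ) - a), f n =
      ∑ m ∈ Finset.Icc 1 ⌊(x - a) / q⌋₊, f (a + q * m) -
        ∑ m ∈ Finset.Icc 1 ⌊-(a : ℝ) / q⌋₊, f (a + q * m) := by
  have hq' : (0 : ℝ) < q := by exact_mod_cast hq
  have hle : ⌊-(a : ℝ) / q⌋₊ ≤ ⌊(x - a) / q⌋₊ := by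
    apply Nat.floor_le_floor
    gcongr
    linarith
  rw [← sum_Ioc_eq_sub (fun m : ℕ => f (a + q * m)) hle]
  symm
  have key : ∀ m ∈ Finset.Ioc ⌊-(a : ℝ) / q⌋₊ ⌊(x - a) / q⌋₊, 0 < m ∧ 0 < a + q * m := by
    intro m hm
    rw [Finset.mem_Ioc] at hm
    refine ⟨by omega, ?_⟩
    have h1 := Nat.lt_of_floor_lt hm.1
    rw [div_lt_iff₀ hq'] at h1
    have : (0 : ℝ) < ((a + q * m : ℤ) : ℝ) := by push_cast; linarith
    exact_mod_cast this
  refine Finset.sum_bij (fun m _ => (a + q * m).toNat) ?_ ?_ ?_ ?_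
  · intro m hm
    obtain ⟨h1, h2⟩ := key m hm
    have h3 : (((a + q * m).toNat : ℕ) : ℤ) = a + q * m := Int.toNat_of_nonneg h2.le
    rw [Finset.mem_Ioc] at hm
    simp only [Finset.mem_filter, Finset.mem_Icc, h3]
    refine ⟨⟨by omega, ?_⟩, ?_, ⟨m, by ring⟩⟩
    · apply Nat.le_floor
      have h4 : (((a + q * m).toNat : ℕ) : ℝ) = a + q * m := by
        exact_mod_cast congrArg (Int.cast : ℤ → ℝ) h3
      rw [h4]
      have h5 := (Nat.le_floor_iff' h1.ne').1 hm.2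
      rw [le_div_iff₀ hq'] at h5
      linarith
    · have : 0 < (q : ℤ) * m := by positivity
      linarith
  · intro m hm n hn h
    have h1 := (key m hm).2
    have h2 := (key n hn).2
    have h3 : a + q * m = a + q * n := by
      have := congrArg (Nat.cast : ℕ → ℤ) h
      rwa [Int.toNat_of_nonneg h1.le, Int.toNat_of_nonneg h2.le] at this
    have h4 : (q : ℤ) * m = q * n := by linarith
    exact_mod_cast mul_left_cancel₀ (by exact_mod_cast hq.ne') h4
  · intro n hn
    simp only [Finset.mem_filter, Finset.mem_Icc] at hn
    obtain ⟨⟨h1, h2⟩, h3, k, hk⟩ := hn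
    have hk0 : 0 < k := by
      have : 0 < (q : ℤ) * k := by linarith
      exact pos_of_mul_pos_right this (by positivity)
    have hkk : ((k.toNat : ℕ) : ℤ) = k := Int.toNat_of_nonneg hk0.le
    have hn' : (n : ℤ) = a + q * k := by linarith
    have hnr : (n : ℝ) = a + q * (k.toNat : ℕ) := by
      have := congrArg (Int.cast : ℤ → ℝ) hn'
      rw [← hkk] at this
      push_cast at this
      exact this
    have hnx := (Nat.le_floor_iff' (by omega)).1 h2
    have hn1 : (1 : ℝ) ≤ n := by exact_mod_cast h1
    refine ⟨k.toNat, ?_, by rw [hkk, ← hn']; simp⟩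
    rw [Finset.mem_Ioc]
    constructor
    · rw [Nat.floor_lt' (by omega), div_lt_iff₀ hq']
      linarith
    · apply Nat.le_floor
      rw [le_div_iff₀ hq']
      linarith
  · intro m hm
    rw [Int.toNat_of_nonneg (key m hm).2.le]

theorem density_nonneg {P : Finset ℕ} (hP : ∀ p ∈ P, p.Prime) : 0 ≤ density P :=
  Finset.prod_nonneg fun p hp => sub_nonneg.2 (inv_le_one_of_one_le₀
    (by exact_mod_cast (hP p hp).one_lt.le))

theorem density_le_one {P : Finset ℕ} (hP : ∀ p ∈ P, p.Prime) : density P ≤ 1 :=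
  Finset.prod_le_one (fun p hp => sub_nonneg.2 (inv_le_one_of_one_le₀
    (by exact_mod_cast (hP p hp).one_lt.le))) fun p _ => sub_le_self _ (by positivity)

theorem sum_inv_le (n : ℕ) : ∑ k ∈ Finset.Icc 1 n, (k : ℝ)⁻¹ ≤ 1 + Real.log n := by
  have := harmonic_le_one_add_log n
  rw [harmonic_eq_sum_Icc] at this
  push_cast at this
  exact this

theorem abs_sum_small_moduli_sub_le {r s : ℕ} {a : ℤ} (ha : a ≠ 0) (hrs : Squarefree (r * s))
    (hra : r.Coprime a.natAbs) (hsa : s ∣ a.natAbs) {U : ℝ} (hU : 0 < U) :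
    |∑ q ∈ Finset.Icc 1 ⌊U⌋₊, (if Avoids a.natAbs.primeFactors q then
        ∑ m ∈ Finset.Icc 1 ⌊U ^ 2 / q⌋₊, divisorWeight (r * s) (a + q * m) else 0) -
      (if s = 1 then U ^ 2 / r * (density a.natAbs.primeFactors *
        (Real.log U - Real.log r + Real.eulerMascheroniConstant + logSum a.natAbs.primeFactors))
        else 0)| ≤
      2 * sigmaReal (r * s) * U + 2 ^ a.natAbs.primeFactors.card * 2 * U := by
  set P := a.natAbs.primeFactors with hPdef
  have hP : ∀ p ∈ P, p.Prime := fun p hp => Nat.prime_of_mem_primeFactors hp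
  have hr0 : 0 < r := Nat.pos_of_ne_zero (left_ne_zero_of_mul hrs.ne_zero)
  have hr0' : (0 : ℝ) < r := by exact_mod_cast hr0
  have hσ := sigmaReal_nonneg (r * s)
  have inner_approx : |∑ q ∈ Finset.Icc 1 ⌊U⌋₊, (if Avoids P q then
        ∑ m ∈ Finset.Icc 1 ⌊U ^ 2 / q⌋₊, divisorWeight (r * s) (a + q * m) else 0) -
      ∑ q ∈ Finset.Icc 1 ⌊U⌋₊, (if Avoids P q then (if r * s ∣ q then U ^ 2 / q else 0) else 0)| ≤
      2 * sigmaReal (r * s) * U := by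
    rw [← Finset.sum_sub_distrib]
    refine (Finset.abs_sum_le_sum_abs _ _).trans ?_
    calc _ ≤ ∑ q ∈ Finset.Icc 1 ⌊U⌋₊, 2 * sigmaReal (r * s) := by
          refine Finset.sum_le_sum fun q hq => ?_
          rw [Finset.mem_Icc] at hq
          split_ifs with h1 h2
          · have := abs_sum_divisorWeight_sub_le hrs (by omega : q ≠ 0)
              ((coprime_natAbs_iff_avoids ha q).2 h1) (z := U ^ 2 / q) (by positivity)
            rwa [if_pos h2] at this
          · have := abs_sum_divisorWeight_sub_le hrs (by omega : q ≠ 0)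
              ((coprime_natAbs_iff_avoids ha q).2 h1) (z := U ^ 2 / q) (by positivity)
            rwa [if_neg h2] at this
          · simpa using hσ
      _ ≤ _ := by
          rw [Finset.sum_const, nsmul_eq_mul, Nat.card_Icc, Nat.add_sub_cancel, mul_comm]
          exact mul_le_mul_of_nonneg_left (Nat.floor_le hU.le) (by linarith)
  have harmonic_approx : |∑ q ∈ Finset.Icc 1 ⌊U⌋₊,
        (if Avoids P q then (if r * s ∣ q then U ^ 2 / q else 0) else 0) -
      (if s = 1 then U ^ 2 / r * (density P *
        (Real.log U - Real.log r + Real.eulerMascheroniConstant + logSum P)) else 0)| ≤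
      2 ^ P.card * 2 * U := by
    by_cases hs : s = 1
    · subst hs
      simp only [mul_one, if_true]
      have e1 : ∑ q ∈ Finset.Icc 1 ⌊U⌋₊,
          (if Avoids P q then (if r ∣ q then U ^ 2 / q else 0) else 0) =
          U ^ 2 / r * ∑ k ∈ Finset.Icc 1 ⌊U / r⌋₊, (if Avoids P k then (k : ℝ)⁻¹ else 0) := by
        have := sum_multiples (fun q => if Avoids P q then U ^ 2 / q else 0) U hr0
        rw [Finset.mul_sum]
        calc _ = ∑ q ∈ Finset.Icc 1 ⌊U⌋₊,
              (if r ∣ q then (if Avoids P q then U ^ 2 / q else 0) else 0) := by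
              refine Finset.sum_congr rfl fun q _ => ?_
              split_ifs <;> rfl
          _ = _ := by
              rw [this]
              refine Finset.sum_congr rfl fun k _ => ?_
              have h1 : Avoids P (r * k) ↔ Avoids P k := by
                rw [← coprime_natAbs_iff_avoids ha, ← coprime_natAbs_iff_avoids ha,
                  Nat.coprime_mul_iff_left]
                exact ⟨fun h => h.2, fun h => ⟨hra, h⟩⟩
              simp only [h1]
              split_ifs
              · push_cast
                rw [div_mul_eq_div_div, div_eq_mul_inv (U ^ 2 / r)]
              · simp
      have hH := abs_avoids_harmonic_sub_le hP (div_pos hU hr0')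
      rw [Real.log_div hU.ne' hr0'.ne'] at hH
      rw [e1, ← mul_sub, abs_mul, abs_of_pos (by positivity)]
      calc _ ≤ U ^ 2 / r * (2 ^ P.card * (2 / (U / r))) := by gcongr
        _ = _ := by field_simp
    · rw [if_neg hs, Finset.sum_eq_zero]
      · simp only [sub_zero, abs_zero]
        positivity
      · intro q _
        split_ifs with h1 h2
        · exfalso
          have h3 := ((coprime_natAbs_iff_avoids ha q).2 h1)
          have h4 := Nat.dvd_gcd ((dvd_mul_left s r).trans h2) hsa
          rw [h3.gcd_eq_one] at h4
          exact hs (Nat.dvd_one.1 h4)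
        · rfl
        · rfl
  exact (abs_sub_le _ _ _).trans (add_le_add inner_approx harmonic_approx)

theorem abs_sum_negative_part_le {r : ℕ} {a : ℤ} (ha : a ≠ 0) (hr : Squarefree r) {x : ℝ}
    (hax : |(a : ℝ)| ≤ x) :
    |∑ q ∈ Finset.Icc 1 ⌊x⌋₊, (if Avoids a.natAbs.primeFactors q then
        ∑ m ∈ Finset.Icc 1 ⌊-(a : ℝ) / q⌋₊, divisorWeight r (a + q * m) else 0)| ≤
      |(a : ℝ)| / r * (1 + Real.log |(a : ℝ)|) + 2 * sigmaReal r * |(a : ℝ)| := by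
  set P := a.natAbs.primeFactors with hPdef
  have hσ := sigmaReal_nonneg r
  have hr0 : 0 < r := Nat.pos_of_ne_zero hr.ne_zero
  set N := a.natAbs with hN
  have hNa : (N : ℝ) = |(a : ℝ)| := by rw [hN, Nat.cast_natAbs, Int.cast_abs]
  have hsub : Finset.Icc 1 N ⊆ Finset.Icc 1 ⌊x⌋₊ :=
    Finset.Icc_subset_Icc_right (Nat.le_floor (by rw [hNa]; exact hax))
  rw [← Finset.sum_subset hsub]
  · refine (Finset.abs_sum_le_sum_abs _ _).trans ?_
    rw [← hNa]
    calc _ ≤ ∑ q ∈ Finset.Icc 1 N, ((if r ∣ q then (N : ℝ) / q else 0) + 2 * sigmaReal r) := by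
          refine Finset.sum_le_sum fun q hq => ?_
          rw [Finset.mem_Icc] at hq
          have hnn : 0 ≤ (if r ∣ q then (N : ℝ) / q else 0) := by split_ifs <;> positivity
          rcases lt_or_ge (-(a : ℝ)) 0 with h0 | h0
          · rw [Nat.floor_of_nonpos (div_nonpos_of_nonpos_of_nonneg h0.le (Nat.cast_nonneg q))]
            simp only [Finset.Icc_eq_empty_of_lt Nat.zero_lt_one, Finset.sum_empty, ite_self,
              abs_zero]
            linarith
          · split_ifs with h1 h2
            · have := abs_sum_divisorWeight_sub_le hr (by omega : q ≠ 0)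
                ((coprime_natAbs_iff_avoids ha q).2 h1) (z := -(a : ℝ) / q) (by positivity)
              rw [if_pos h2] at this
              have e : (N : ℝ) = -a := by rw [hNa, abs_of_nonpos (by linarith)]
              rw [e]
              have h3 := abs_sub_abs_le_abs_sub (∑ m ∈ Finset.Icc 1 ⌊-(a : ℝ) / q⌋₊,
                divisorWeight r (a + q * m)) (-(a : ℝ) / q)
              have h4 : |-(a : ℝ) / q| = -(a : ℝ) / q := abs_of_nonneg (by positivity)
              linarith
            · have := abs_sum_divisorWeight_sub_le hr (by omega : q ≠ 0)
                ((coprime_natAbs_iff_avoids ha q).2 h1) (z := -(a : ℝ) / q) (by positivity)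
              rw [if_neg h2, sub_zero] at this
              linarith
            all_goals
              rw [abs_zero]
              positivity
      _ ≤ _ := by
          have e1 := sum_multiples (fun q => (N : ℝ) / q) (N : ℝ) hr0
          rw [Nat.floor_natCast] at e1
          rw [Finset.sum_add_distrib, e1, Finset.sum_const, nsmul_eq_mul, Nat.card_Icc,
            Nat.add_sub_cancel, mul_comm (N : ℝ) (2 * sigmaReal r)]
          gcongr
          calc ∑ k ∈ Finset.Icc 1 ⌊(N : ℝ) / r⌋₊, (N : ℝ) / ((r * k : ℕ) : ℝ)
              = N / r * ∑ k ∈ Finset.Icc 1 ⌊(N : ℝ) / r⌋₊, (k : ℝ)⁻¹ := by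
                rw [Finset.mul_sum]
                refine Finset.sum_congr rfl fun k _ => ?_
                push_cast
                rw [div_mul_eq_div_div, div_eq_mul_inv ((N : ℝ) / r)]
            _ ≤ N / r * ∑ k ∈ Finset.Icc 1 N, (k : ℝ)⁻¹ := by
                gcongr
                rw [Nat.floor_div_natCast, Nat.floor_natCast]
                exact Nat.div_le_self _ _
            _ ≤ _ := by gcongr; exact sum_inv_le N
  · intro q hq1 hq2
    rw [Finset.mem_Icc] at hq1 hq2
    have hq : N < q := by omega
    have hqr : (N : ℝ) < q := by exact_mod_cast hq
    have hf : ⌊-(a : ℝ) / q⌋₊ = 0 := by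
      rw [Nat.floor_eq_zero, div_lt_one (lt_of_le_of_lt (Nat.cast_nonneg N) hqr)]
      exact lt_of_le_of_lt (hNa ▸ neg_le_abs (a : ℝ)) hqr
    rw [hf]
    simp

theorem sigmaReal_le_of_dvd {s r : ℕ} (hr : r ≠ 0) (h : s ∣ r) : sigmaReal s ≤ sigmaReal r :=
  Finset.sum_le_sum_of_subset_of_nonneg (Nat.divisors_subset_of_dvd hr h)
    fun _ _ _ => by positivity

theorem abs_sum_large_moduli_sub_le {r s : ℕ} {a : ℤ} (ha : a ≠ 0) (hrs : Squarefree (r * s))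
    (hra : r.Coprime a.natAbs) (hsa : s ∣ a.natAbs) {U x : ℝ} (hU : 0 < U) (hUx : U ≤ x)
    (hax : |(a : ℝ)| ≤ x) (hUa : U ^ 2 = x - a) :
    |∑ q ∈ Finset.Ioc ⌊U⌋₊ ⌊x⌋₊, (if Avoids a.natAbs.primeFactors q then
        ∑ m ∈ Finset.Icc 1 ⌊U ^ 2 / q⌋₊, divisorWeight (r * s) (a + q * m) else 0) -
      density a.natAbs.primeFactors * (U ^ 2 / r * ((if s = 1 then
        Real.log U - Real.log r + Real.eulerMascheroniConstant - 1 else 0) +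
          ArithmeticFunction.vonMangoldt s))| ≤
      2 ^ a.natAbs.primeFactors.card * 4 * sigmaReal (r * s) * U + 3 * sigmaReal (r * s) * U +
        density a.natAbs.primeFactors * (if r = 1 then |(a : ℝ)| else 0) := by
  set P := a.natAbs.primeFactors with hPdef
  have hP : ∀ p ∈ P, p.Prime := fun p hp => Nat.prime_of_mem_primeFactors hp
  have hw0 := density_nonneg hP
  have hw1 := density_le_one hP
  have hr : Squarefree r := hrs.squarefree_of_dvd (dvd_mul_right _ _)
  have hσ := sigmaReal_nonneg (r * s)
  have hx0 : 0 < x := hU.trans_le hUx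
  set Z : ℕ → ℝ := fun m => min x (U ^ 2 / m) with hZ
  have hmZ : ∀ m ∈ Finset.Icc 1 ⌊U⌋₊, 0 < m ∧ U ≤ Z m := by
    intro m hm
    rw [Finset.mem_Icc] at hm
    have h1 : (m : ℝ) ≤ U := (Nat.le_floor_iff hU.le).1 hm.2
    have h0 : (0 : ℝ) < m := by exact_mod_cast hm.1
    refine ⟨hm.1, le_min hUx ?_⟩
    rw [le_div_iff₀ h0]
    nlinarith
  have swap : ∑ q ∈ Finset.Ioc ⌊U⌋₊ ⌊x⌋₊, (if Avoids P q then
        ∑ m ∈ Finset.Icc 1 ⌊U ^ 2 / q⌋₊, divisorWeight (r * s) (a + q * m) else 0) =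
      ∑ m ∈ Finset.Icc 1 ⌊U⌋₊, ∑ q ∈ Finset.Ioc ⌊U⌋₊ ⌊Z m⌋₊,
        (if Avoids P q then divisorWeight (r * s) (a + q * m) else 0) := by
    have e : ∀ q : ℕ, (if Avoids P q then
        ∑ m ∈ Finset.Icc 1 ⌊U ^ 2 / q⌋₊, divisorWeight (r * s) (a + q * m) else 0) =
        ∑ m ∈ Finset.Icc 1 ⌊U ^ 2 / q⌋₊,
          (if Avoids P q then divisorWeight (r * s) (a + q * m) else 0) := by
      intro q; split_ifs <;> simp
    simp only [e]
    refine Finset.sum_comm' fun q m => ?_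
    simp only [Finset.mem_Ioc, Finset.mem_Icc]
    constructor
    · rintro ⟨⟨h1, h2⟩, h3, h4⟩
      have hq0 : q ≠ 0 := by omega
      have hq : U < q := (Nat.floor_lt' hq0).1 h1
      have hqx : (q : ℝ) ≤ x := (Nat.le_floor_iff' hq0).1 h2
      have hm0 : (0 : ℝ) < m := by exact_mod_cast h3
      have h5 := (Nat.le_floor_iff' (by omega)).1 h4
      rw [le_div_iff₀ (hU.trans hq)] at h5
      refine ⟨⟨h1, Nat.le_floor (le_min hqx ?_)⟩, h3, Nat.le_floor ?_⟩
      · rw [le_div_iff₀ hm0]; linarith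
      · by_contra! h6
        nlinarith
    · rintro ⟨⟨h1, h2⟩, h3, h4⟩
      have hq0 : q ≠ 0 := by omega
      have hq : U < q := (Nat.floor_lt' hq0).1 h1
      have hm0 : (0 : ℝ) < m := by exact_mod_cast h3
      have h5 := (Nat.le_floor_iff' hq0).1 h2
      have h6 : (q : ℝ) ≤ U ^ 2 / m := h5.trans (min_le_right _ _)
      rw [le_div_iff₀ hm0] at h6
      refine ⟨⟨h1, Nat.le_floor (h5.trans (min_le_left _ _))⟩, h3, Nat.le_floor ?_⟩
      rw [le_div_iff₀ (hU.trans hq)]; linarith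
  rw [swap]
  have inner_approx : |∑ m ∈ Finset.Icc 1 ⌊U⌋₊, ∑ q ∈ Finset.Ioc ⌊U⌋₊ ⌊Z m⌋₊,
        (if Avoids P q then divisorWeight (r * s) (a + q * m) else 0) -
      ∑ m ∈ Finset.Icc 1 ⌊U⌋₊, density P * (Z m - U) * meanWeight r s m| ≤
      2 ^ P.card * 4 * sigmaReal (r * s) * U := by
    rw [← Finset.sum_sub_distrib]
    refine (Finset.abs_sum_le_sum_abs _ _).trans ?_
    calc _ ≤ ∑ m ∈ Finset.Icc 1 ⌊U⌋₊, 2 ^ P.card * 4 * sigmaReal (r * s) := by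
          refine Finset.sum_le_sum fun m hm => ?_
          obtain ⟨hm0, hmU⟩ := hmZ m hm
          rw [sum_Ioc_eq_sub _ (Nat.floor_le_floor hmU)]
          have b1 := abs_sum_avoids_divisorWeight_sub_le ha hr hra hsa hm0.ne'
            (hU.le.trans hmU)
          have b2 := abs_sum_avoids_divisorWeight_sub_le ha hr hra hsa hm0.ne' hU.le
          have e : ∀ A B : ℝ, A - B - density P * (Z m - U) * meanWeight r s m =
              (A - density P * Z m * meanWeight r s m) -
                (B - density P * U * meanWeight r s m) := by
            intro A B; ring
          rw [e]
          refine (abs_sub _ _).trans ?_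
          linarith
      _ ≤ _ := by
          rw [Finset.sum_const, nsmul_eq_mul, Nat.card_Icc, Nat.add_sub_cancel, mul_comm]
          exact mul_le_mul_of_nonneg_left (Nat.floor_le hU.le) (by positivity)
  have length_approx : |∑ m ∈ Finset.Icc 1 ⌊U⌋₊, density P * (Z m - U) * meanWeight r s m -
      density P * ∑ m ∈ Finset.Icc 1 ⌊U⌋₊, (U ^ 2 / m - U) * meanWeight r s m| ≤
      density P * (if r = 1 then |(a : ℝ)| else 0) := by
    rw [Finset.mul_sum, ← Finset.sum_sub_distrib]
    have e : ∀ m ∈ Finset.Icc 1 ⌊U⌋₊, density P * (Z m - U) * meanWeight r s m -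
        density P * ((U ^ 2 / m - U) * meanWeight r s m) =
        if m = 1 then density P * ((Z 1 - U ^ 2) * meanWeight r s 1) else 0 := by
      intro m hm
      rw [Finset.mem_Icc] at hm
      split_ifs with h1
      · subst h1
        rw [Nat.cast_one, div_one]; ring
      · have h2 : (2 : ℝ) ≤ m := by exact_mod_cast (by omega : 2 ≤ m)
        have h3 : Z m = U ^ 2 / m := by
          refine min_eq_right ?_
          rw [div_le_iff₀ (by linarith), hUa]
          have := neg_le_abs (a : ℝ)
          nlinarith
        rw [h3]; ring
    rw [Finset.sum_congr rfl e, Finset.sum_ite_eq']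
    have h1 : meanWeight r s 1 = if r = 1 then 1 else 0 := by
      rw [meanWeight]
      simp only [Nat.dvd_one]
      congr 1
      rw [Finset.sum_ite_eq' s.divisors 1, if_pos]
      · simp
      · exact Nat.one_mem_divisors.2 (right_ne_zero_of_mul hrs.ne_zero)
    have h2 : |Z 1 - U ^ 2| ≤ |(a : ℝ)| := by
      simp only [hZ, Nat.cast_one, div_one, hUa]
      rcases min_choice x (x - (a : ℝ)) with h | h <;> rw [h]
      · simp
      · simp
    rw [h1]
    split_ifs
    · rw [mul_one, abs_mul, abs_of_nonneg hw0]
      gcongr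
    all_goals simp
    positivity
  have mean_approx := abs_sum_meanWeight_sub_le hr.ne_zero (hra.coprime_dvd_right hsa) hU
  have scale_bound : ∀ A B : ℝ, |A - B| ≤ sigmaReal s * (3 * U) →
      |density P * A - density P * B| ≤ 3 * sigmaReal (r * s) * U := by
    intro A B h
    rw [← mul_sub, abs_mul, abs_of_nonneg hw0]
    have h1 := sigmaReal_le_of_dvd hrs.ne_zero (dvd_mul_left s r)
    calc _ ≤ 1 * (sigmaReal (r * s) * (3 * U)) := by
          refine mul_le_mul hw1 (h.trans ?_) (abs_nonneg _) zero_le_one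
          gcongr
      _ = _ := by ring
  have mean_scaled := scale_bound _ _ mean_approx
  have := abs_sub_le _ _ _ |>.trans (add_le_add (abs_sub_le _ _ _ |>.trans
    (add_le_add inner_approx length_approx)) mean_scaled)
  linarith

/-- The main term contributed by the squarefree modulus `r` to the average of `F_R`, over a range of
length `y`. -/
noncomputable def modulusMainTerm (a : ℤ) (y : ℝ) (r : ℕ) : ℝ :=
  density a.natAbs.primeFactors * (y / (r / r.gcd a.natAbs : ℕ) *
    ((if r.Coprime a.natAbs then
      Real.log y - 2 * Real.log r + 2 * Real.eulerMascheroniConstant - 1 +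
        logSum a.natAbs.primeFactors else 0) + ArithmeticFunction.vonMangoldt (r.gcd a.natAbs)))

theorem one_le_sigmaReal {r : ℕ} (hr : r ≠ 0) : 1 ≤ sigmaReal r := by
  have := sigmaReal_le_of_dvd hr (one_dvd r)
  simpa [sigmaReal] using this

theorem abs_sum_modulus_sub_le {r : ℕ} {a : ℤ} (ha : a ≠ 0) (hr : Squarefree r) {x : ℝ}
    (hx : 2 ≤ x) (hax : |(a : ℝ)| < √x) :
    |∑ q ∈ Finset.Icc 1 ⌊x⌋₊, (if Avoids a.natAbs.primeFactors q then
        ∑ n ∈ (Finset.Icc 1 ⌊x⌋₊).filter (fun n : ℕ => a < (n : ℤ) ∧ (q : ℤ) ∣ (n : ℤ) - a),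
          divisorWeight r n else 0) - modulusMainTerm a (x - a) r| ≤
      24 * 2 ^ a.natAbs.primeFactors.card * sigmaReal r * √x +
        |(a : ℝ)| / r * (1 + Real.log |(a : ℝ)|) +
        density a.natAbs.primeFactors * (if r ∣ a.natAbs then |(a : ℝ)| else 0) := by
  set P := a.natAbs.primeFactors with hPdef
  have hx0 : 0 ≤ x := by linarith
  have hsq : √x ^ 2 = x := Real.sq_sqrt hx0
  have hs1 : 1.4 ≤ √x := Real.le_sqrt_of_sq_le (by norm_num; linarith)
  have hsx : √x ≤ x := by nlinarith
  have hax' : |(a : ℝ)| ≤ x := hax.le.trans hsx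
  have hy0 : 0 < x - a := by linarith [le_abs_self (a : ℝ)]
  set U := √(x - a) with hUdef
  have hU : 0 < U := Real.sqrt_pos.2 hy0
  have hU2 : U ^ 2 = x - a := Real.sq_sqrt hy0.le
  have hna := neg_le_abs (a : ℝ)
  have hUx : U ≤ x := Real.sqrt_le_iff.2 ⟨hx0, by nlinarith⟩
  have hU2x : U ≤ 2 * √x := Real.sqrt_le_iff.2 ⟨by positivity, by nlinarith⟩
  set g := r.gcd a.natAbs with hg
  have hg0 : 0 < g := Nat.gcd_pos_of_pos_left _ (Nat.pos_of_ne_zero hr.ne_zero)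
  have hrg : r / g * g = r := Nat.div_mul_cancel (Nat.gcd_dvd_left _ _)
  have hcop : (r / g).Coprime a.natAbs :=
    Nat.coprime_div_gcd_of_squarefree hr (Int.natAbs_ne_zero.2 ha)
  have hga : g ∣ a.natAbs := Nat.gcd_dvd_right _ _
  have hrg' : Squarefree (r / g * g) := by rwa [hrg]
  have b1 := abs_sum_small_moduli_sub_le ha hrg' hcop hga hU
  have b2 := abs_sum_large_moduli_sub_le ha hrg' hcop hga hU hUx hax' hU2
  have b3 := abs_sum_negative_part_le ha hr hax'
  rw [hrg] at b1 b2
  rw [← hPdef] at b1 b2 b3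
  have e1 : ∑ q ∈ Finset.Icc 1 ⌊x⌋₊, (if Avoids P q then
        ∑ n ∈ (Finset.Icc 1 ⌊x⌋₊).filter (fun n : ℕ => a < (n : ℤ) ∧ (q : ℤ) ∣ (n : ℤ) - a),
          divisorWeight r n else 0) =
      ∑ q ∈ Finset.Icc 1 ⌊U⌋₊, (if Avoids P q then
        ∑ m ∈ Finset.Icc 1 ⌊U ^ 2 / q⌋₊, divisorWeight r (a + q * m) else 0) +
      ∑ q ∈ Finset.Ioc ⌊U⌋₊ ⌊x⌋₊, (if Avoids P q then
        ∑ m ∈ Finset.Icc 1 ⌊U ^ 2 / q⌋₊, divisorWeight r (a + q * m) else 0) -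
      ∑ q ∈ Finset.Icc 1 ⌊x⌋₊, (if Avoids P q then
        ∑ m ∈ Finset.Icc 1 ⌊-(a : ℝ) / q⌋₊, divisorWeight r (a + q * m) else 0) := by
    rw [sum_Ioc_eq_sub _ (Nat.floor_le_floor hUx), add_sub_cancel, ← Finset.sum_sub_distrib]
    refine Finset.sum_congr rfl fun q hq => ?_
    rw [Finset.mem_Icc] at hq
    rw [sum_progression_eq (divisorWeight r) (by omega) a hx0, hU2]
    split_ifs <;> simp
  have e2 : modulusMainTerm a (x - a) r =
      (if g = 1 then U ^ 2 / (r / g : ℕ) * (density P * (Real.log U - Real.log (r / g : ℕ) +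
        Real.eulerMascheroniConstant + logSum P)) else 0) +
      density P * (U ^ 2 / (r / g : ℕ) * ((if g = 1 then Real.log U - Real.log (r / g : ℕ) +
        Real.eulerMascheroniConstant - 1 else 0) + ArithmeticFunction.vonMangoldt g)) := by
    have hlog : Real.log (x - a) = 2 * Real.log U := by
      rw [← hU2, Real.log_pow]; norm_num
    rw [modulusMainTerm, ← hPdef, hlog, ← hU2, ← hg]
    by_cases h : g = 1
    · rw [if_pos (show r.Coprime a.natAbs from h), if_pos h, if_pos h, h, Nat.div_one]
      ring
    · rw [if_neg (show ¬r.Coprime a.natAbs from h), if_neg h, if_neg h]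
      ring
  have hσ := one_le_sigmaReal hr.ne_zero
  have h2P : (1 : ℝ) ≤ 2 ^ P.card := one_le_pow₀ (by norm_num)
  have e3 : (if r / g = 1 then |(a : ℝ)| else 0) = if r ∣ a.natAbs then |(a : ℝ)| else 0 := by
    congr 1
    rw [eq_iff_iff, Nat.div_eq_iff_eq_mul_left hg0 (Nat.gcd_dvd_left _ _), one_mul, eq_comm,
      hg, Nat.gcd_eq_left_iff_dvd]
  rw [e3] at b2
  rw [e1, e2]
  have c0 : ∀ A B C M N : ℝ, |A + B - C - (M + N)| ≤ |A - M| + |B - N| + |C| := by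
    intro A B C M N
    have : A + B - C - (M + N) = (A - M) + (B - N) - C := by ring
    rw [this]
    exact (abs_sub _ _).trans (add_le_add (abs_add_le _ _) le_rfl)
  refine (c0 _ _ _ _ _).trans ?_
  have k1 : 1 * 1 ≤ 2 ^ P.card * sigmaReal r := mul_le_mul h2P hσ (by norm_num) (by positivity)
  have k2 : sigmaReal r ≤ 2 ^ P.card * sigmaReal r := le_mul_of_one_le_left (by linarith) h2P
  have k3 : (2 : ℝ) ^ P.card ≤ 2 ^ P.card * sigmaReal r := le_mul_of_one_le_right (by linarith) hσ
  have k4 : sigmaReal r * |(a : ℝ)| ≤ 2 ^ P.card * sigmaReal r * √x := by gcongr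
  have k5 : 2 ^ P.card * sigmaReal r * U ≤ 2 ^ P.card * sigmaReal r * (2 * √x) := by gcongr
  have k6 : sigmaReal r * U ≤ 2 ^ P.card * sigmaReal r * U := by gcongr
  have k7 : 2 ^ P.card * U ≤ 2 ^ P.card * sigmaReal r * U := by gcongr
  linarith

theorem sum_prod_primeFactors_le {A Q : Finset ℕ} (hA : ∀ r ∈ A, Squarefree r ∧ r.primeFactors ⊆ Q)
    {h : ℕ → ℝ} (h0 : ∀ p ∈ Q, 0 ≤ h p) :
    ∑ r ∈ A, ∏ p ∈ r.primeFactors, h p ≤ ∏ p ∈ Q, (1 + h p) := by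
  rw [Finset.prod_one_add]
  have hinj : Set.InjOn Nat.primeFactors (A : Set ℕ) := by
    intro r hr s hs hrs
    rw [← Nat.prod_primeFactors_of_squarefree (hA r hr).1,
      ← Nat.prod_primeFactors_of_squarefree (hA s hs).1]
    exact congrArg (fun t : Finset ℕ => ∏ p ∈ t, p) hrs
  rw [← Finset.sum_image (f := fun t : Finset ℕ => ∏ p ∈ t, h p) hinj]
  refine Finset.sum_le_sum_of_subset_of_nonneg ?_ ?_
  · intro t ht
    obtain ⟨r, hr, rfl⟩ := Finset.mem_image.1 ht
    exact Finset.mem_powerset.2 (hA r hr).2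
  · intro t ht _
    exact Finset.prod_nonneg fun p hp => h0 p (Finset.mem_powerset.1 ht hp)

theorem prod_one_add_two_div_le (N : ℕ) :
    ∏ p ∈ (Finset.Icc 1 N).filter Nat.Prime, (1 + 2 / ((p : ℝ) * (p - 1))) ≤ Real.exp 2 := by
  have h0 : ∀ n ∈ Finset.Icc 2 N, (0 : ℝ) ≤ 2 / ((n : ℝ) * (n - 1)) := by
    intro n hn
    rw [Finset.mem_Icc] at hn
    have : (2 : ℝ) ≤ n := by exact_mod_cast hn.1
    exact div_nonneg zero_le_two (mul_nonneg (by linarith) (by linarith))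
  have hsub : (Finset.Icc 1 N).filter Nat.Prime ⊆ Finset.Icc 2 N := by
    intro p hp
    simp only [Finset.mem_filter, Finset.mem_Icc] at hp ⊢
    exact ⟨hp.2.two_le, hp.1.2⟩
  have htel : ∀ M : ℕ, ∑ n ∈ Finset.Icc 2 (M + 1), 2 / ((n : ℝ) * (n - 1)) ≤ 2 - 2 / (M + 1) := by
    intro M
    induction M with
    | zero => simp
    | succ M ih =>
      rw [Finset.sum_Icc_succ_top (by omega)]
      have : (2 : ℝ) / (((M + 1 + 1 : ℕ) : ℝ) * (((M + 1 + 1 : ℕ) : ℝ) - 1)) =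
          2 / (M + 1) - 2 / (M + 1 + 1) := by
        push_cast
        have h1 : (M : ℝ) + 1 ≠ 0 := by positivity
        have h2 : (M : ℝ) + 1 + 1 ≠ 0 := by positivity
        have h3 : (M : ℝ) + 1 + 1 - 1 = M + 1 := by ring
        rw [h3]
        field_simp
        ring
      rw [this]
      push_cast
      linarith
  have hsum : ∑ n ∈ Finset.Icc 2 N, 2 / ((n : ℝ) * (n - 1)) ≤ 2 := by
    rcases N with _ | M
    · simp
    · have : (0 : ℝ) ≤ 2 / (M + 1) := by positivity
      linarith [htel M]
  calc _ ≤ ∏ p ∈ (Finset.Icc 1 N).filter Nat.Prime, Real.exp (2 / ((p : ℝ) * (p - 1))) := by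
        refine Finset.prod_le_prod (fun p hp => ?_) (fun p hp => ?_)
        · linarith [h0 p (hsub hp)]
        · linarith [Real.add_one_le_exp (2 / ((p : ℝ) * (p - 1)))]
    _ = Real.exp (∑ p ∈ (Finset.Icc 1 N).filter Nat.Prime, 2 / ((p : ℝ) * (p - 1))) :=
        (Real.exp_sum _ _).symm
    _ ≤ Real.exp 2 := by
        refine Real.exp_le_exp.2 (le_trans ?_ hsum)
        exact Finset.sum_le_sum_of_subset_of_nonneg hsub fun n hn _ => h0 n hn

theorem cast_eq_prod_of_squarefree {r : ℕ} (hr : Squarefree r) :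
    (r : ℝ) = ∏ p ∈ r.primeFactors, (p : ℝ) := by
  conv_lhs => rw [← Nat.prod_primeFactors_of_squarefree hr]
  push_cast; rfl

theorem totient_eq_prod_of_squarefree {r : ℕ} (hr : Squarefree r) :
    (Nat.totient r : ℝ) = ∏ p ∈ r.primeFactors, ((p : ℝ) - 1) := by
  have h4 : (Nat.totient r : ℝ) = r * ∏ p ∈ r.primeFactors, (1 - (p : ℝ)⁻¹) := by
    have := congrArg (fun t : ℚ => (t : ℝ)) (Nat.totient_eq_mul_prod_factors r)
    push_cast at this
    exact this
  rw [h4, cast_eq_prod_of_squarefree hr, ← Finset.prod_mul_distrib]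
  refine Finset.prod_congr rfl fun p hp => ?_
  have : (p : ℝ) ≠ 0 := by exact_mod_cast (Nat.prime_of_mem_primeFactors hp).ne_zero
  field_simp

theorem sigmaReal_eq_prod_of_squarefree {r : ℕ} (hr : Squarefree r) :
    sigmaReal r = ∏ p ∈ r.primeFactors, (1 + (p : ℝ)) := by
  have := ArithmeticFunction.IsMultiplicative.prodPrimeFactors_one_add_of_squarefree
    (R := ℝ) (f := (ArithmeticFunction.id : ArithmeticFunction ℕ))
    (ArithmeticFunction.isMultiplicative_id.natCast) hr
  simp only [ArithmeticFunction.natCoe_apply, ArithmeticFunction.id_apply] at this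
  rw [this, sigmaReal]

theorem primeFactors_subset_primes {r N : ℕ} (hr : r ∈ Finset.Icc 1 N) :
    r.primeFactors ⊆ (Finset.Icc 1 N).filter Nat.Prime := by
  intro p hp
  rw [Finset.mem_Icc] at hr
  have h1 := Nat.prime_of_mem_primeFactors hp
  have h2 := Nat.le_of_mem_primeFactors hp
  simp only [Finset.mem_filter, Finset.mem_Icc]
  exact ⟨⟨h1.one_lt.le, h2.trans hr.2⟩, h1⟩

theorem sum_inv_mul_totient_le (N : ℕ) :
    ∑ r ∈ (Finset.Icc 1 N).filter Squarefree, 1 / ((r : ℝ) * Nat.totient r) ≤ Real.exp 2 := by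
  have h1 : ∀ p ∈ (Finset.Icc 1 N).filter Nat.Prime, (0 : ℝ) < (p : ℝ) * (p - 1) := by
    intro p hp
    have : (1 : ℝ) < p := by exact_mod_cast (Finset.mem_filter.1 hp).2.one_lt
    exact mul_pos (by linarith) (by linarith)
  calc _ = ∑ r ∈ (Finset.Icc 1 N).filter Squarefree,
        ∏ p ∈ r.primeFactors, 1 / ((p : ℝ) * (p - 1)) := by
        refine Finset.sum_congr rfl fun r hr => ?_
        have hr' := (Finset.mem_filter.1 hr).2
        rw [totient_eq_prod_of_squarefree hr', Finset.prod_div_distrib, Finset.prod_mul_distrib,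
          ← cast_eq_prod_of_squarefree hr', Finset.prod_const_one]
    _ ≤ ∏ p ∈ (Finset.Icc 1 N).filter Nat.Prime, (1 + 1 / ((p : ℝ) * (p - 1))) := by
        refine sum_prod_primeFactors_le (fun r hr => ?_) fun p hp => ?_
        · rw [Finset.mem_filter] at hr
          exact ⟨hr.2, primeFactors_subset_primes hr.1⟩
        · exact (one_div_pos.2 (h1 p hp)).le
    _ ≤ ∏ p ∈ (Finset.Icc 1 N).filter Nat.Prime, (1 + 2 / ((p : ℝ) * (p - 1))) := by
        refine Finset.prod_le_prod (fun p hp => ?_) fun p hp => ?_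
        · linarith [(one_div_pos.2 (h1 p hp)).le]
        · have := h1 p hp
          gcongr
          norm_num
    _ ≤ _ := prod_one_add_two_div_le N

theorem sum_sigmaReal_div_totient_le (N : ℕ) :
    ∑ r ∈ (Finset.Icc 1 N).filter Squarefree, sigmaReal r / Nat.totient r ≤ Real.exp 2 * N := by
  set Q := (Finset.Icc 1 N).filter Nat.Prime with hQ
  have h1 : ∀ p ∈ Q, (1 : ℝ) < p := by
    intro p hp
    exact_mod_cast (Finset.mem_filter.1 hp).2.one_lt
  calc _ = ∑ r ∈ (Finset.Icc 1 N).filter Squarefree, ∑ t ∈ r.primeFactors.powerset,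
        ∏ p ∈ t, 2 / ((p : ℝ) - 1) := by
        refine Finset.sum_congr rfl fun r hr => ?_
        have hr' := Finset.mem_filter.1 hr
        rw [totient_eq_prod_of_squarefree hr'.2, sigmaReal_eq_prod_of_squarefree hr'.2,
          ← Finset.prod_div_distrib, ← Finset.prod_one_add]
        refine Finset.prod_congr rfl fun p hp => ?_
        have := h1 p (primeFactors_subset_primes hr'.1 hp)
        have h2 : (p : ℝ) - 1 ≠ 0 := by linarith
        field_simp
        ring
    _ ≤ ∑ r ∈ Finset.Icc 1 N, ∑ t ∈ Q.powerset,
        (if (∏ p ∈ t, p) ∣ r then ∏ p ∈ t, 2 / ((p : ℝ) - 1) else 0) := by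
        have hnn : ∀ t ∈ Q.powerset, 0 ≤ ∏ p ∈ t, 2 / ((p : ℝ) - 1) := by
          intro t ht
          refine Finset.prod_nonneg fun p hp => ?_
          have := h1 p (Finset.mem_powerset.1 ht hp)
          exact div_nonneg zero_le_two (by linarith)
        refine (Finset.sum_le_sum fun r hr => ?_).trans
          (Finset.sum_le_sum_of_subset_of_nonneg (Finset.filter_subset _ _) fun r _ _ => ?_)
        · have hr' := Finset.mem_filter.1 hr
          rw [← Finset.sum_filter]
          refine Finset.sum_le_sum_of_subset_of_nonneg (fun t ht => ?_)
            fun t ht _ => hnn t (Finset.mem_filter.1 ht).1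
          rw [Finset.mem_powerset] at ht
          rw [Finset.mem_filter, Finset.mem_powerset]
          exact ⟨ht.trans (primeFactors_subset_primes hr'.1),
            (Finset.prod_dvd_prod_of_subset _ _ _ ht).trans (Nat.prod_primeFactors_dvd r)⟩
        · refine Finset.sum_nonneg fun t ht => ?_
          split_ifs
          · exact hnn t ht
          · exact le_rfl
    _ ≤ ∑ t ∈ Q.powerset, (∏ p ∈ t, 2 / ((p : ℝ) * (p - 1))) * N := by
        rw [Finset.sum_comm]
        refine Finset.sum_le_sum fun t ht => ?_
        rw [Finset.mem_powerset] at ht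
        have hpos : 0 < ∏ p ∈ t, p :=
          Finset.prod_pos fun p hp => (Finset.mem_filter.1 (ht hp)).2.pos
        have e := sum_multiples (fun _ => ∏ p ∈ t, 2 / ((p : ℝ) - 1)) (N : ℝ) hpos
        rw [Nat.floor_natCast] at e
        rw [e, Finset.sum_const, nsmul_eq_mul, Nat.card_Icc, Nat.add_sub_cancel]
        have hnn : 0 ≤ ∏ p ∈ t, 2 / ((p : ℝ) - 1) := by
          refine Finset.prod_nonneg fun p hp => ?_
          have := h1 p (ht hp)
          exact div_nonneg zero_le_two (by linarith)
        calc _ ≤ (N : ℝ) / ((∏ p ∈ t, p : ℕ) : ℝ) * ∏ p ∈ t, 2 / ((p : ℝ) - 1) := by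
              gcongr
              exact Nat.floor_le (by positivity)
          _ = _ := by
              have : ∏ p ∈ t, 2 / ((p : ℝ) * (p - 1)) =
                  (∏ p ∈ t, 2 / ((p : ℝ) - 1)) / ((∏ p ∈ t, p : ℕ) : ℝ) := by
                push_cast
                rw [← Finset.prod_div_distrib]
                refine Finset.prod_congr rfl fun p hp => ?_
                rw [div_div, mul_comm]
              rw [this]
              ring
    _ = (∏ p ∈ Q, (1 + 2 / ((p : ℝ) * (p - 1)))) * N := by
        rw [← Finset.sum_mul, Finset.prod_one_add]
    _ ≤ _ := by
        gcongr
        exact prod_one_add_two_div_le N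

theorem density_mul_sum_inv_totient_le (a : ℕ) (ha : a ≠ 0) (N : ℕ) :
    density a.primeFactors * ∑ r ∈ (Finset.Icc 1 N).filter Squarefree,
      (if r ∣ a then 1 / (Nat.totient r : ℝ) else 0) ≤ 1 := by
  have hP : ∀ p ∈ a.primeFactors, p.Prime := fun p hp => Nat.prime_of_mem_primeFactors hp
  have hp1 : ∀ p ∈ a.primeFactors, (1 : ℝ) < p := fun p hp => by exact_mod_cast (hP p hp).one_lt
  have h1 : ∑ r ∈ (Finset.Icc 1 N).filter Squarefree,
      (if r ∣ a then 1 / (Nat.totient r : ℝ) else 0) ≤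
      ∏ p ∈ a.primeFactors, (1 + 1 / ((p : ℝ) - 1)) := by
    rw [← Finset.sum_filter]
    calc _ = ∑ r ∈ ((Finset.Icc 1 N).filter Squarefree).filter (fun r => r ∣ a),
          ∏ p ∈ r.primeFactors, 1 / ((p : ℝ) - 1) := by
          refine Finset.sum_congr rfl fun r hr => ?_
          simp only [Finset.mem_filter] at hr
          rw [totient_eq_prod_of_squarefree hr.1.2, Finset.prod_div_distrib,
            Finset.prod_const_one]
      _ ≤ _ := by
          refine sum_prod_primeFactors_le (fun r hr => ?_) fun p hp => ?_
          · simp only [Finset.mem_filter] at hr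
            exact ⟨hr.1.2, Nat.primeFactors_mono hr.2 ha⟩
          · have := hp1 p hp
            exact div_nonneg zero_le_one (by linarith)
  refine (mul_le_mul_of_nonneg_left h1 (density_nonneg hP)).trans ?_
  rw [density, ← Finset.prod_mul_distrib, Finset.prod_eq_one]
  intro p hp
  have := hp1 p hp
  have h2 : (p : ℝ) - 1 ≠ 0 := by linarith
  field_simp
  ring

theorem FR_eq_sum_divisorWeight (R : ℝ) (n : ℤ) :
    FR R n = ∑ r ∈ (Finset.Icc 1 ⌊R⌋₊).filter Squarefree,
      1 / (Nat.totient r : ℝ) * divisorWeight r n := by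
  rw [FR, Finset.sum_filter]
  refine Finset.sum_congr rfl fun r _ => ?_
  split_ifs with hr
  · have h1 : (ArithmeticFunction.moebius r : ℝ) ^ 2 = 1 := by
      exact_mod_cast ArithmeticFunction.moebius_sq_eq_one_of_squarefree hr
    rw [divisorWeight_eq hr, h1]
    ring
  · rw [ArithmeticFunction.moebius_eq_zero_of_not_squarefree hr]
    simp

theorem sum_rhoStar_eq {a : ℤ} (ha : a ≠ 0) (R x : ℝ) :
    ∑ q ∈ (Finset.Icc 1 ⌊x⌋₊).filter (fun q : ℕ => Int.gcd (q : ℤ) a = 1), rhoStar R x q a =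
      ∑ r ∈ (Finset.Icc 1 ⌊R⌋₊).filter Squarefree, 1 / (Nat.totient r : ℝ) *
        ∑ q ∈ Finset.Icc 1 ⌊x⌋₊, (if Avoids a.natAbs.primeFactors q then
          ∑ n ∈ (Finset.Icc 1 ⌊x⌋₊).filter (fun n : ℕ => a < (n : ℤ) ∧ (q : ℤ) ∣ (n : ℤ) - a),
            divisorWeight r n else 0) := by
  simp only [← Finset.sum_filter, Finset.mul_sum]
  rw [Finset.sum_comm]
  refine Finset.sum_congr (Finset.filter_congr fun q _ => coprime_natAbs_iff_avoids ha q)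
    fun q _ => ?_
  rw [Finset.sum_comm, rhoStar]
  exact Finset.sum_congr rfl fun n _ => FR_eq_sum_divisorWeight R n

theorem sum_moebius_sq_div_le (N : ℕ) (s : ℕ) :
    ∑ t ∈ (Finset.Icc 1 N).filter (fun t => t.Coprime s),
      (ArithmeticFunction.moebius t : ℝ) ^ 2 / ((t : ℝ) * Nat.totient t) ≤ Real.exp 2 := by
  refine le_trans ?_ (sum_inv_mul_totient_le N)
  rw [Finset.sum_filter, Finset.sum_filter]
  refine Finset.sum_le_sum fun t _ => ?_
  by_cases ht : Squarefree t
  · have h1 : (ArithmeticFunction.moebius t : ℝ) ^ 2 = 1 := by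
      exact_mod_cast ArithmeticFunction.moebius_sq_eq_one_of_squarefree ht
    rw [h1, if_pos ht]
    split_ifs
    · exact le_rfl
    · positivity
  · rw [ArithmeticFunction.moebius_eq_zero_of_not_squarefree ht]
    simp [ht]

theorem sum_vonMangoldt_gcd_eq {s : ℕ} (hs : s ≠ 0) (R : ℝ) :
    ∑ r ∈ (Finset.Icc 1 ⌊R⌋₊).filter Squarefree, 1 / (Nat.totient r : ℝ) *
        (1 / (r / r.gcd s : ℕ) * ArithmeticFunction.vonMangoldt (r.gcd s)) =
      ∑ p ∈ s.primeFactors, (Real.log p / ((p : ℝ) - 1)) *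
        ∑ t ∈ (Finset.Icc 1 ⌊R / (p : ℝ)⌋₊).filter (fun t => t.Coprime s),
          (ArithmeticFunction.moebius t : ℝ) ^ 2 / ((t : ℝ) * Nat.totient t) := by
  have key : ∀ p ∈ s.primeFactors, (Real.log p / ((p : ℝ) - 1)) *
        ∑ t ∈ (Finset.Icc 1 ⌊R / (p : ℝ)⌋₊).filter (fun t => t.Coprime s),
          (ArithmeticFunction.moebius t : ℝ) ^ 2 / ((t : ℝ) * Nat.totient t) =
      ∑ r ∈ Finset.Icc 1 ⌊R⌋₊, (if p ∣ r then if Squarefree r ∧ r.gcd s = p then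
        1 / (Nat.totient r : ℝ) * (1 / (r / p : ℕ) * Real.log p) else 0 else 0) := by
    intro p hp
    have hpp := Nat.prime_of_mem_primeFactors hp
    have hps := Nat.dvd_of_mem_primeFactors hp
    rw [sum_multiples _ R hpp.pos, Finset.mul_sum, Finset.sum_filter]
    refine Finset.sum_congr rfl fun t ht => ?_
    rw [Nat.mul_div_cancel_left _ hpp.pos]
    by_cases hts : t.Coprime s
    · have hpt : p.Coprime t := (Nat.Coprime.coprime_dvd_right hps hts).symm
      have hg : (p * t).gcd s = p := by
        rw [hts.gcd_mul_right_cancel, Nat.gcd_eq_left hps]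
      rw [if_pos hts, hg]
      by_cases hsq : Squarefree t
      · have h1 : (ArithmeticFunction.moebius t : ℝ) ^ 2 = 1 := by
          exact_mod_cast ArithmeticFunction.moebius_sq_eq_one_of_squarefree hsq
        rw [if_pos ⟨(Nat.squarefree_mul hpt).2 ⟨hpp.prime.squarefree, hsq⟩, rfl⟩, h1,
          Nat.totient_mul hpt, Nat.totient_prime hpp, Nat.cast_mul, Nat.cast_sub hpp.one_lt.le,
          Nat.cast_one]
        simp only [mul_inv, div_eq_mul_inv]
        ring
      · rw [if_neg fun h => hsq ((Nat.squarefree_mul hpt).1 h.1).2,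
          ArithmeticFunction.moebius_eq_zero_of_not_squarefree hsq]
        simp
    · rw [if_neg hts, if_neg]
      rintro ⟨h1, h2⟩
      have hpt := Nat.coprime_of_squarefree_mul h1
      apply hts
      have h3 : t.gcd s ∣ p := h2 ▸ Nat.dvd_gcd ((Nat.gcd_dvd_left t s).mul_left p)
        (Nat.gcd_dvd_right t s)
      exact Nat.eq_one_of_dvd_coprimes hpt h3 (Nat.gcd_dvd_left t s)
  rw [Finset.sum_congr rfl key, Finset.sum_comm, Finset.sum_filter]
  refine Finset.sum_congr rfl fun r _ => ?_
  by_cases hr : Squarefree r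
  · rw [if_pos hr]
    by_cases hg : (r.gcd s).Prime
    · have hmem : r.gcd s ∈ s.primeFactors :=
        Nat.mem_primeFactors.2 ⟨hg, Nat.gcd_dvd_right _ _, hs⟩
      rw [Finset.sum_eq_single_of_mem _ hmem, if_pos (Nat.gcd_dvd_left _ _), if_pos ⟨hr, rfl⟩,
        ArithmeticFunction.vonMangoldt_apply_prime hg]
      intro p _ hpg
      rw [if_neg (fun h : Squarefree r ∧ r.gcd s = p => hpg h.2.symm), ite_self]
    · have h0 : ArithmeticFunction.vonMangoldt (r.gcd s) = 0 := by
        rw [ArithmeticFunction.vonMangoldt_eq_zero_iff]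
        exact fun h => hg (Nat.squarefree_and_prime_pow_iff_prime.1
          ⟨hr.squarefree_of_dvd (Nat.gcd_dvd_left _ _), h⟩)
      rw [h0, mul_zero, mul_zero, Finset.sum_eq_zero]
      intro p hp
      rw [if_neg (fun h : Squarefree r ∧ r.gcd s = p =>
        hg (h.2 ▸ Nat.prime_of_mem_primeFactors hp)), ite_self]
  · rw [if_neg hr, Finset.sum_eq_zero]
    intro p _
    rw [if_neg (fun h : Squarefree r ∧ r.gcd s = p => hr h.1), ite_self]

theorem sum_modulusMainTerm_eq {a : ℤ} (ha : a ≠ 0) (R y : ℝ) :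
    ∑ r ∈ (Finset.Icc 1 ⌊R⌋₊).filter Squarefree, 1 / (Nat.totient r : ℝ) * modulusMainTerm a y r =
      y * density a.natAbs.primeFactors *
          ∑ r ∈ (Finset.Icc 1 ⌊R⌋₊).filter (fun r => r.Coprime a.natAbs),
            (ArithmeticFunction.moebius r : ℝ) ^ 2 / ((r : ℝ) * Nat.totient r) *
              (Real.log y - 2 * Real.log r + 2 * Real.eulerMascheroniConstant - 1 +
                logSum a.natAbs.primeFactors) +
        y * density a.natAbs.primeFactors *
          ∑ p ∈ a.natAbs.primeFactors, (Real.log p / ((p : ℝ) - 1)) *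
            ∑ t ∈ (Finset.Icc 1 ⌊R / (p : ℝ)⌋₊).filter (fun t => t.Coprime a.natAbs),
              (ArithmeticFunction.moebius t : ℝ) ^ 2 / ((t : ℝ) * Nat.totient t) := by
  rw [← sum_vonMangoldt_gcd_eq (Int.natAbs_ne_zero.2 ha), Finset.mul_sum, Finset.mul_sum,
    Finset.sum_filter, Finset.sum_filter, Finset.sum_filter, ← Finset.sum_add_distrib]
  refine Finset.sum_congr rfl fun r _ => ?_
  by_cases hr : Squarefree r
  · have h1 : (ArithmeticFunction.moebius r : ℝ) ^ 2 = 1 := by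
      exact_mod_cast ArithmeticFunction.moebius_sq_eq_one_of_squarefree hr
    rw [if_pos hr, if_pos hr, modulusMainTerm, h1]
    by_cases hc : r.Coprime a.natAbs
    · rw [if_pos hc, if_pos hc, hc.gcd_eq_one, Nat.div_one]
      simp only [mul_inv, div_eq_mul_inv]
      ring
    · rw [if_neg hc, if_neg hc]
      simp only [div_eq_mul_inv]
      ring
  · rw [if_neg hr, if_neg hr, ArithmeticFunction.moebius_eq_zero_of_not_squarefree hr]
    simp

theorem logSum_nonneg {P : Finset ℕ} (hP : ∀ p ∈ P, p.Prime) : 0 ≤ logSum P := by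
  refine Finset.sum_nonneg fun p hp => ?_
  have : (1 : ℝ) < p := by exact_mod_cast (hP p hp).one_lt
  exact div_nonneg (Real.log_nonneg this.le) (by linarith)

theorem logSum_primeFactors_le {s : ℕ} (hs : s ≠ 0) : logSum s.primeFactors ≤ Real.log s := by
  calc logSum s.primeFactors ≤ ∑ p ∈ s.primeFactors, Real.log p := by
        refine Finset.sum_le_sum fun p hp => ?_
        have : (2 : ℝ) ≤ p := by exact_mod_cast (Nat.prime_of_mem_primeFactors hp).two_le
        exact div_le_self (Real.log_nonneg (by linarith)) (by linarith)
    _ = Real.log (∏ p ∈ s.primeFactors, (p : ℝ)) :=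
        (Real.log_prod fun p hp => by
          exact_mod_cast (Nat.prime_of_mem_primeFactors hp).ne_zero).symm
    _ ≤ Real.log s := by
        have h := Nat.le_of_dvd (Nat.pos_of_ne_zero hs) (Nat.prod_primeFactors_dvd s)
        rw [← Nat.cast_prod]
        refine Real.log_le_log ?_ (by exact_mod_cast h)
        rw [Nat.cast_prod]
        refine Finset.prod_pos fun p hp => ?_
        exact_mod_cast (Nat.prime_of_mem_primeFactors hp).pos

theorem density_primeFactors_eq {s : ℕ} (hs : s ≠ 0) :
    density s.primeFactors = (Nat.totient s : ℝ) / s := by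
  have h := congrArg (fun t : ℚ => (t : ℝ)) (Nat.totient_eq_mul_prod_factors s)
  push_cast at h
  rw [density, h, mul_div_cancel_left₀ _ (by exact_mod_cast hs)]

theorem abs_mul_log_sub_mul_log_le {x y : ℝ} (hx : 1 ≤ x) (hy : 0 < y) (hyx : y ≤ 2 * x) :
    |x * Real.log x - y * Real.log y| ≤ |x - y| * (Real.log x + 2) := by
  have hx0 : 0 < x := by linarith
  have hlx := Real.log_nonneg hx
  have h1 : y * (Real.log x - Real.log y) ≤ x - y := by
    have := Real.log_le_sub_one_of_pos (div_pos hx0 hy)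
    rw [Real.log_div hx0.ne' hy.ne'] at this
    calc _ ≤ y * (x / y - 1) := by gcongr
      _ = x - y := by field_simp
  have h2 : x * (Real.log y - Real.log x) ≤ y - x := by
    have := Real.log_le_sub_one_of_pos (div_pos hy hx0)
    rw [Real.log_div hy.ne' hx0.ne'] at this
    calc _ ≤ x * (y / x - 1) := by gcongr
      _ = y - x := by field_simp
  have h3 : y * Real.log y - y * Real.log x ≤ 2 * |x - y| := by
    rcases le_total y x with h | h
    · have : Real.log y ≤ Real.log x := Real.log_le_log hy h
      nlinarith [abs_nonneg (x - y)]
    · have : 0 ≤ Real.log y - Real.log x := sub_nonneg.2 (Real.log_le_log hx0 h)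
      have h4 := neg_abs_le (x - y)
      nlinarith
  have h5 : |x * Real.log x - y * Real.log y| =
      |(x - y) * Real.log x + y * (Real.log x - Real.log y)| := by ring_nf
  rw [h5]
  refine (abs_add_le _ _).trans ?_
  rw [abs_mul, abs_of_nonneg hlx]
  have : |y * (Real.log x - Real.log y)| ≤ 2 * |x - y| := by
    rw [abs_le]
    constructor
    · linarith
    · linarith [le_abs_self (x - y), abs_nonneg (x - y)]
  linarith

theorem abs_sum_modulusMainTerm_sub_le {a : ℤ} (ha : a ≠ 0) {x R : ℝ} (hx : 2 ≤ x)
    (hax : |(a : ℝ)| < √x) (hR : R ≤ √x) :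
    |∑ r ∈ (Finset.Icc 1 ⌊R⌋₊).filter Squarefree,
        1 / (Nat.totient r : ℝ) * modulusMainTerm a (x - a) r -
      ∑ r ∈ (Finset.Icc 1 ⌊R⌋₊).filter Squarefree,
        1 / (Nat.totient r : ℝ) * modulusMainTerm a x r| ≤
      Real.exp 2 * |(a : ℝ)| * (3 * Real.log x + 3) := by
  have hP : ∀ p ∈ a.natAbs.primeFactors, p.Prime := fun p hp => Nat.prime_of_mem_primeFactors hp
  have hx0 : 0 ≤ x := by linarith
  have hlx : 0 ≤ Real.log x := Real.log_nonneg (by linarith)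
  have hsq : √x ^ 2 = x := Real.sq_sqrt hx0
  have hs1 : 1.4 ≤ √x := Real.le_sqrt_of_sq_le (by norm_num; linarith)
  have hsx : √x < x := by nlinarith
  have hlogs : Real.log √x = Real.log x / 2 := Real.log_sqrt hx0
  have hw0 := density_nonneg hP
  have hw1 := density_le_one hP
  have hS0 := logSum_nonneg hP
  have hS1 : logSum a.natAbs.primeFactors ≤ Real.log x := by
    refine (logSum_primeFactors_le (Int.natAbs_ne_zero.2 ha)).trans ?_
    rw [Nat.cast_natAbs, Int.cast_abs]
    exact Real.log_le_log (by simpa using ha) (by linarith)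
  rw [sum_modulusMainTerm_eq ha, sum_modulusMainTerm_eq ha]
  set w := density a.natAbs.primeFactors
  set S := logSum a.natAbs.primeFactors with hSdef
  set D := ∑ p ∈ a.natAbs.primeFactors, (Real.log p / ((p : ℝ) - 1)) *
    ∑ t ∈ (Finset.Icc 1 ⌊R / (p : ℝ)⌋₊).filter (fun t => t.Coprime a.natAbs),
      (ArithmeticFunction.moebius t : ℝ) ^ 2 / ((t : ℝ) * Nat.totient t)
  set T := (Finset.Icc 1 ⌊R⌋₊).filter (fun r => r.Coprime a.natAbs) with hT
  set β : ℕ → ℝ := fun r => (ArithmeticFunction.moebius r : ℝ) ^ 2 / ((r : ℝ) * Nat.totient r)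
  have hβ : ∀ r, 0 ≤ β r := fun r => by positivity
  set B := ∑ r ∈ T, β r with hBdef
  have hB0 : 0 ≤ B := Finset.sum_nonneg fun r _ => hβ r
  have hB1 : B ≤ Real.exp 2 := sum_moebius_sq_div_le _ _
  have hD : |D| ≤ Real.exp 2 * Real.log x := by
    have h0 : 0 ≤ D ∧ D ≤ S * Real.exp 2 := by
      rw [hSdef, logSum, Finset.sum_mul]
      have hp0 : ∀ p ∈ a.natAbs.primeFactors, 0 ≤ Real.log p / ((p : ℝ) - 1) := by
        intro p hp
        have : (1 : ℝ) < p := by exact_mod_cast (hP p hp).one_lt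
        exact div_nonneg (Real.log_nonneg this.le) (by linarith)
      exact ⟨Finset.sum_nonneg fun p hp =>
          mul_nonneg (hp0 p hp) (Finset.sum_nonneg fun t _ => by positivity),
        Finset.sum_le_sum fun p hp =>
          mul_le_mul_of_nonneg_left (sum_moebius_sq_div_le _ _) (hp0 p hp)⟩
    rw [abs_of_nonneg h0.1, mul_comm]
    exact h0.2.trans (by gcongr)
  set K := ∑ r ∈ T, β r * (-(2 * Real.log r) + 2 * Real.eulerMascheroniConstant - 1 + S) with hK
  have hKle : |K| ≤ Real.exp 2 * (Real.log x + 1) := by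
    calc |K| ≤ ∑ r ∈ T, β r * (Real.log x + 1) := by
          refine (Finset.abs_sum_le_sum_abs _ _).trans (Finset.sum_le_sum fun r hr => ?_)
          rw [abs_mul, abs_of_nonneg (hβ r)]
          refine mul_le_mul_of_nonneg_left ?_ (hβ r)
          rw [hT, Finset.mem_filter, Finset.mem_Icc] at hr
          have hr1 : (1 : ℝ) ≤ r := by exact_mod_cast hr.1.1
          have hr2 : (r : ℝ) ≤ √x := by
            have h := (Nat.le_floor_iff' (by omega)).1 hr.1.2
            exact h.trans hR
          have hl0 := Real.log_nonneg hr1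
          have hl1 := Real.log_le_log (by linarith) hr2
          have g1 := Real.one_half_lt_eulerMascheroniConstant
          have g2 := Real.eulerMascheroniConstant_lt_two_thirds
          rw [abs_le]
          constructor <;> linarith
      _ = B * (Real.log x + 1) := by rw [hBdef, Finset.sum_mul]
      _ ≤ _ := by gcongr
  have hsplit : ∀ y : ℝ, ∑ r ∈ T, β r * (Real.log y - 2 * Real.log r +
      2 * Real.eulerMascheroniConstant - 1 + S) = B * Real.log y + K := by
    intro y
    rw [hBdef, hK, Finset.sum_mul, ← Finset.sum_add_distrib]
    exact Finset.sum_congr rfl fun r _ => by ring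
  rw [hsplit, hsplit]
  have hid : (x - a) * w * (B * Real.log (x - a) + K) + (x - a) * w * D -
      (x * w * (B * Real.log x + K) + x * w * D) =
      -(w * (B * (x * Real.log x - (x - a) * Real.log (x - a)) + a * K + a * D)) := by ring
  have hL := abs_mul_log_sub_mul_log_le (x := x) (y := x - a) (by linarith)
    (by linarith [le_abs_self (a : ℝ)]) (by linarith [neg_abs_le (a : ℝ)])
  rw [sub_sub_cancel] at hL
  rw [hid, abs_neg, abs_mul, abs_of_nonneg hw0]
  refine (mul_le_of_le_one_left (abs_nonneg _) hw1).trans ?_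
  refine ((abs_add_le _ _).trans (add_le_add_left (abs_add_le _ _) _)).trans ?_
  rw [abs_mul, abs_mul, abs_mul, abs_of_nonneg hB0]
  have t1 := mul_le_mul hB1 hL (abs_nonneg _) (Real.exp_pos 2).le
  have t2 := mul_le_mul_of_nonneg_left hKle (abs_nonneg (a : ℝ))
  have t3 := mul_le_mul_of_nonneg_left hD (abs_nonneg (a : ℝ))
  linarith

theorem abs_sum_rhoStar_sub_le {a : ℤ} (ha : a ≠ 0) {x R : ℝ} (hx : 2 ≤ x)
    (hax : |(a : ℝ)| < √x) (hR0 : 0 ≤ R) :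
    |∑ q ∈ (Finset.Icc 1 ⌊x⌋₊).filter (fun q : ℕ => Int.gcd (q : ℤ) a = 1), rhoStar R x q a -
      ∑ r ∈ (Finset.Icc 1 ⌊R⌋₊).filter Squarefree,
        1 / (Nat.totient r : ℝ) * modulusMainTerm a (x - a) r| ≤
      24 * Real.exp 2 * 2 ^ a.natAbs.primeFactors.card * R * √x +
        Real.exp 2 * |(a : ℝ)| * (1 + Real.log |(a : ℝ)|) + |(a : ℝ)| := by
  have ha1 : (1 : ℝ) ≤ |(a : ℝ)| := by exact_mod_cast Int.one_le_abs ha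
  rw [sum_rhoStar_eq ha, ← Finset.sum_sub_distrib]
  refine (Finset.abs_sum_le_sum_abs _ _).trans ?_
  set c := (2 : ℝ) ^ a.natAbs.primeFactors.card
  set w := density a.natAbs.primeFactors
  set Q := (Finset.Icc 1 ⌊R⌋₊).filter Squarefree with hQ
  calc _ ≤ ∑ r ∈ Q, (24 * c * √x * (sigmaReal r / Nat.totient r) +
        |(a : ℝ)| * (1 + Real.log |(a : ℝ)|) * (1 / ((r : ℝ) * Nat.totient r)) +
        |(a : ℝ)| * (w * (if r ∣ a.natAbs then 1 / (Nat.totient r : ℝ) else 0))) := by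
        refine Finset.sum_le_sum fun r hr => ?_
        have hr' := (Finset.mem_filter.1 hr).2
        rw [← mul_sub, abs_mul, abs_of_nonneg (by positivity : 0 ≤ 1 / (Nat.totient r : ℝ))]
        refine (mul_le_mul_of_nonneg_left (abs_sum_modulus_sub_le ha hr' hx hax)
          (by positivity)).trans_eq ?_
        simp only [mul_inv, div_eq_mul_inv]
        split_ifs <;> ring
    _ = 24 * c * √x * ∑ r ∈ Q, sigmaReal r / Nat.totient r +
        |(a : ℝ)| * (1 + Real.log |(a : ℝ)|) * ∑ r ∈ Q, 1 / ((r : ℝ) * Nat.totient r) +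
        |(a : ℝ)| * (w * ∑ r ∈ Q, (if r ∣ a.natAbs then 1 / (Nat.totient r : ℝ) else 0)) := by
        simp only [Finset.sum_add_distrib, ← Finset.mul_sum]
    _ ≤ 24 * c * √x * (Real.exp 2 * R) + |(a : ℝ)| * (1 + Real.log |(a : ℝ)|) * Real.exp 2 +
        |(a : ℝ)| * 1 := by
        have h1 : ∑ r ∈ Q, sigmaReal r / Nat.totient r ≤ Real.exp 2 * R :=
          (sum_sigmaReal_div_totient_le _).trans
            (mul_le_mul_of_nonneg_left (Nat.floor_le hR0) (Real.exp_pos 2).le)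
        have h2 := sum_inv_mul_totient_le ⌊R⌋₊
        have h3 := density_mul_sum_inv_totient_le a.natAbs (Int.natAbs_ne_zero.2 ha) ⌊R⌋₊
        have hl := Real.log_nonneg ha1
        gcongr
    _ = _ := by ring

/-- the average of `ρ_R*` over all moduli `q ≤ x` coprime to `a`. -/
theorem rho_full_range_coprime :
    ∃ C : ℝ, 0 < C ∧ ∀ x : ℝ, 2 ≤ x → ∀ a : ℤ, a ≠ 0 → |(a : ℝ)| < x ^ ((1 : ℝ) / 2) →
      ∀ R : ℝ, 1 ≤ R → R ≤ x ^ ((1 : ℝ) / 2) →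
      |(∑ q ∈ (Finset.Icc 1 ⌊x⌋₊).filter (fun q : ℕ => Int.gcd (q : ℤ) a = 1),
            rhoStar R x q a)
          - x * ((Nat.totient a.natAbs : ℝ) / (a.natAbs : ℝ)) *
              ∑ r ∈ (Finset.Icc 1 ⌊R⌋₊).filter (fun r : ℕ => Int.gcd (r : ℤ) a = 1),
                (ArithmeticFunction.moebius r : ℝ) ^ 2 / ((r : ℝ) * (Nat.totient r : ℝ)) *
                  (Real.log (x / (r : ℝ) ^ 2) + 2 * Real.eulerMascheroniConstant - 1 +
                    ∑ p ∈ a.natAbs.primeFactors, Real.log p / ((p : ℝ) - 1))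
          - x * ((Nat.totient a.natAbs : ℝ) / (a.natAbs : ℝ)) *
              ∑ p ∈ a.natAbs.primeFactors, (Real.log p / ((p : ℝ) - 1)) *
                ∑ t ∈ (Finset.Icc 1 ⌊R / (p : ℝ)⌋₊).filter
                    (fun t : ℕ => Int.gcd (t : ℤ) a = 1),
                  (ArithmeticFunction.moebius t : ℝ) ^ 2 / ((t : ℝ) * (Nat.totient t : ℝ))|
        ≤ C * (|(a : ℝ)| * Real.log x
            + (2 : ℝ) ^ a.natAbs.primeFactors.card * R * x ^ ((1 : ℝ) / 2)) := by
  refine ⟨24 * Real.exp 2, by positivity, fun x hx a ha hax R hR1 hR => ?_⟩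
  rw [← Real.sqrt_eq_rpow] at hax hR ⊢
  have hx0 : 0 < x := by linarith
  have hsq : √x ^ 2 = x := Real.sq_sqrt hx0.le
  have hs1 : 1.4 ≤ √x := Real.le_sqrt_of_sq_le (by norm_num; linarith)
  have hsx : √x < x := by nlinarith
  have ha1 : (1 : ℝ) ≤ |(a : ℝ)| := by exact_mod_cast Int.one_le_abs ha
  have hlog1 : 1 ≤ 2 * Real.log x := by
    have := Real.log_le_log two_pos hx
    linarith [Real.log_two_gt_d9]
  have hloga : Real.log |(a : ℝ)| ≤ Real.log x := Real.log_le_log (by linarith) (by linarith)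
  have hmain := sum_modulusMainTerm_eq ha R x
  rw [density_primeFactors_eq (Int.natAbs_ne_zero.2 ha)] at hmain
  have hlogr : ∀ r ∈ (Finset.Icc 1 ⌊R⌋₊).filter (fun r => r.Coprime a.natAbs),
      (ArithmeticFunction.moebius r : ℝ) ^ 2 / ((r : ℝ) * Nat.totient r) *
        (Real.log x - 2 * Real.log r + 2 * Real.eulerMascheroniConstant - 1 +
          logSum a.natAbs.primeFactors) =
      (ArithmeticFunction.moebius r : ℝ) ^ 2 / ((r : ℝ) * Nat.totient r) *
        (Real.log (x / (r : ℝ) ^ 2) + 2 * Real.eulerMascheroniConstant - 1 +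
          ∑ p ∈ a.natAbs.primeFactors, Real.log p / ((p : ℝ) - 1)) := by
    intro r hr
    have hr0 : (r : ℝ) ≠ 0 := by
      rw [Finset.mem_filter, Finset.mem_Icc] at hr
      exact_mod_cast (by omega : r ≠ 0)
    rw [Real.log_div hx0.ne' (pow_ne_zero 2 hr0), Real.log_pow, logSum, Nat.cast_ofNat]
  rw [Finset.sum_congr rfl hlogr] at hmain
  rw [sub_sub]
  refine (le_of_eq (congrArg (fun t => |_ - t|) hmain.symm)).trans ?_
  refine (abs_sub_le _ _ _).trans ((add_le_add (abs_sum_rhoStar_sub_le ha hx hax (by linarith))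
    (abs_sum_modulusMainTerm_sub_le ha hx hax hR)).trans ?_)
  have he : 1 ≤ Real.exp 2 := Real.one_le_exp (by norm_num)
  have h1 : Real.exp 2 * |(a : ℝ)| * (1 + Real.log |(a : ℝ)|) ≤
      Real.exp 2 * |(a : ℝ)| * (3 * Real.log x) := by
    gcongr
    linarith
  have h2 : |(a : ℝ)| * 1 ≤ Real.exp 2 * |(a : ℝ)| * (2 * Real.log x) := by
    gcongr
    exact le_mul_of_one_le_left (abs_nonneg _) he
  have h3 : Real.exp 2 * |(a : ℝ)| * (3 * Real.log x + 3) ≤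
      Real.exp 2 * |(a : ℝ)| * (9 * Real.log x) := by
    gcongr
    linarith
  have h4 : 0 ≤ Real.exp 2 * |(a : ℝ)| * Real.log x := by
    have : 0 ≤ Real.log x := by linarith
    positivity
  linarith
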